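/- arXiv:1805.10739 — 15 statements merged into one kernel-verified Lean document; each statement's English description precedes it below -/
import Mathlib

section
/- For every natural number k, the positive integer N_k = 4·(10^(2·3^k) − 1)/33 (whose decimal expansion is the block '12' repeated 3^k times) satisfies s_10(N_k) = 3^(k+1), and 3^(k+1) divides N_k; in particular N_k is a 10-Niven number. -/
/-- The number whose decimal expansion is the block `12` repeated `m` times. -/
def repeatTwelve : ℕ → ℕ
  | 0 => 0
  | m + 1 => 2 + 10 * (1 + 10 * repeatTwelve m)

theorem repeatTwelve_mul (m : ℕ) : 33 * repeatTwelve m + 4 = 4 * 100 ^ m := by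
  induction m with
  | zero => rfl
  | succ m ih =>
    rw [repeatTwelve, pow_succ]
    omega

theorem digits_sum_repeatTwelve (m : ℕ) : (Nat.digits 10 (repeatTwelve m)).sum = 3 * m := by
  induction m with
  | zero => simp [repeatTwelve]
  | succ m ih =>
    rw [repeatTwelve, Nat.digits_add 10 (by norm_num) 2 _ (by norm_num) (by norm_num),
      Nat.digits_add 10 (by norm_num) 1 _ (by norm_num) (by norm_num)]
    simp only [List.sum_cons, ih]
    ring

theorem exists_hundred_pow_three_pow_eq (k : ℕ) : ∃ c, 100 ^ 3 ^ k = 3 ^ (k + 2) * c + 1 := by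
  induction k with
  | zero => exact ⟨11, by norm_num⟩
  | succ k ih =>
    obtain ⟨c, hc⟩ := ih
    refine ⟨c + 3 ^ (k + 2) * c ^ 2 + 3 ^ (2 * k + 3) * c ^ 3, ?_⟩
    rw [pow_succ 3 k, pow_mul, hc]
    ring

theorem three_pow_dvd_repeatTwelve (k : ℕ) : 3 ^ (k + 1) ∣ repeatTwelve (3 ^ k) := by
  obtain ⟨c, hc⟩ := exists_hundred_pow_three_pow_eq k
  have h := repeatTwelve_mul (3 ^ k)
  rw [hc, pow_succ 3 (k + 1)] at h
  have hcop : Nat.Coprime (3 ^ (k + 1)) 11 := Nat.Coprime.pow_left _ (by norm_num)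
  refine hcop.dvd_of_dvd_mul_left ⟨4 * c, ?_⟩
  linarith

/-- For every natural number `k`, the positive integer
`N_k = 4 * (10 ^ (2 * 3 ^ k) - 1) / 33` (decimal expansion: the block `12`
repeated `3 ^ k` times) has decimal digit sum `3 ^ (k + 1)`, and
`3 ^ (k + 1)` divides `N_k`; in particular `N_k` is a 10-Niven number. -/
theorem stmt_0 (k : ℕ) (N : ℕ) (hN : N = 4 * (10 ^ (2 * 3 ^ k) - 1) / 33) :
    (Nat.digits 10 N).sum = 3 ^ (k + 1) ∧ 3 ^ (k + 1) ∣ N := by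
  have hN' : N = repeatTwelve (3 ^ k) := by
    have h := repeatTwelve_mul (3 ^ k)
    rw [pow_mul, show 10 ^ 2 = 100 by norm_num] at hN
    omega
  subst hN'
  exact ⟨by rw [digits_sum_repeatTwelve, pow_succ'], three_pow_dvd_repeatTwelve k⟩
end

section
/- For every natural number k, the positive integer N_k = 4·(10^(2·3^k) − 1)/33 (whose decimal expansion is the block '12' repeated 3^k times) is a 10-ARH number; more precisely, M = N_k/(2·3^(k+1)) is a positive integer and N_k = M·s_10(N_k) + (M·s_10(N_k))^R. -/
/-- The integer whose base-100 expansion consists of `n` digits `1`. -/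
def centRepunit : ℕ → ℕ
  | 0 => 0
  | n + 1 => 1 + 100 * centRepunit n

theorem hundred_pow_eq_centRepunit (n : ℕ) : 100 ^ n = 99 * centRepunit n + 1 := by
  induction n with
  | zero => rfl
  | succ n ih => rw [pow_succ, ih, centRepunit]; ring

theorem three_pow_dvd_centRepunit (k : ℕ) : 3 ^ k ∣ centRepunit (3 ^ k) := by
  suffices h : ∃ c, 100 ^ 3 ^ k = 99 * (3 ^ k * c) + 1 by
    obtain ⟨c, hc⟩ := h
    rw [hundred_pow_eq_centRepunit] at hc
    exact ⟨c, by omega⟩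
  induction k with
  | zero => exact ⟨1, rfl⟩
  | succ k ih =>
    obtain ⟨c, hc⟩ := ih
    refine ⟨c + 99 * 3 ^ k * c ^ 2 + 33 * 99 * (3 ^ k) ^ 2 * c ^ 3, ?_⟩
    rw [pow_succ 3 k, pow_mul, hc]
    ring

theorem centRepunit_pos {n : ℕ} (hn : 0 < n) : 0 < centRepunit n := by
  cases n with
  | zero => omega
  | succ n => rw [centRepunit]; omega

theorem digits_sum_twelve_mul_centRepunit (n : ℕ) :
    (Nat.digits 10 (12 * centRepunit n)).sum = 3 * n := by
  induction n with
  | zero => simp [centRepunit]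
  | succ n ih =>
    have h : 12 * centRepunit (n + 1) = 2 + 10 * (1 + 10 * (12 * centRepunit n)) := by
      rw [centRepunit]; ring
    rw [h, Nat.digits_add 10 (by norm_num) 2 _ (by norm_num) (by omega),
      Nat.digits_add 10 (by norm_num) 1 _ (by norm_num) (by omega), List.sum_cons, List.sum_cons, ih]
    ring

/-- The palindrome `[6, 0, 6, …, 0, 6]` with `n + 1` entries `6`. -/
def sixZeroDigits : ℕ → List ℕ
  | 0 => [6]
  | n + 1 => 6 :: 0 :: sixZeroDigits n

theorem sixZeroDigits_succ_eq_append (n : ℕ) :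
    sixZeroDigits (n + 1) = sixZeroDigits n ++ [0, 6] := by
  induction n with
  | zero => rfl
  | succ n ih => exact congrArg (fun l => 6 :: 0 :: l) ih

theorem reverse_sixZeroDigits (n : ℕ) : (sixZeroDigits n).reverse = sixZeroDigits n := by
  induction n with
  | zero => rfl
  | succ n ih => rw [sixZeroDigits_succ_eq_append, List.reverse_append, ih,
      ← sixZeroDigits_succ_eq_append]; rfl

theorem digits_six_mul_centRepunit_succ (n : ℕ) :
    Nat.digits 10 (6 * centRepunit (n + 1)) = sixZeroDigits n := by
  induction n with
  | zero => simp [centRepunit, sixZeroDigits]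
  | succ n ih =>
    have hpos : 0 < centRepunit (n + 1) := centRepunit_pos n.succ_pos
    have h : 6 * centRepunit (n + 1 + 1) = 6 + 10 * (0 + 10 * (6 * centRepunit (n + 1))) := by
      rw [centRepunit]; ring
    rw [h, Nat.digits_add 10 (by norm_num) 6 _ (by norm_num) (by omega),
      Nat.digits_add 10 (by norm_num) 0 _ (by norm_num) (by omega), ih, sixZeroDigits]

theorem ofDigits_reverse_digits_six_mul_centRepunit {n : ℕ} (hn : 0 < n) :
    Nat.ofDigits 10 (Nat.digits 10 (6 * centRepunit n)).reverse = 6 * centRepunit n := by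
  obtain ⟨m, rfl⟩ := Nat.exists_eq_succ_of_ne_zero hn.ne'
  rw [Nat.succ_eq_add_one, digits_six_mul_centRepunit_succ, reverse_sixZeroDigits,
    ← digits_six_mul_centRepunit_succ, Nat.ofDigits_digits]


/-- For every natural number `k`, the positive integer
`N_k = 4 * (10 ^ (2 * 3 ^ k) - 1) / 33` is a 10-ARH number; more precisely
`M = N_k / (2 * 3 ^ (k + 1))` is a positive integer and
`N_k = M * s₁₀(N_k) + (M * s₁₀(N_k))^R`, where `s₁₀` is the decimal digit sum
and `·^R` is the decimal digit reversal. -/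
theorem stmt_1 (k : ℕ) (N : ℕ) (hN : N = 4 * (10 ^ (2 * 3 ^ k) - 1) / 33) :
    (2 * 3 ^ (k + 1)) ∣ N ∧ 0 < N / (2 * 3 ^ (k + 1)) ∧
      N = (N / (2 * 3 ^ (k + 1))) * (Nat.digits 10 N).sum +
        Nat.ofDigits 10
          (Nat.digits 10 ((N / (2 * 3 ^ (k + 1))) * (Nat.digits 10 N).sum)).reverse := by
  have hpow : 0 < 3 ^ k := by positivity
  have hr := centRepunit_pos hpow
  have hN' : N = 12 * centRepunit (3 ^ k) := by
    rw [hN, pow_mul, show 10 ^ 2 = 100 by norm_num, hundred_pow_eq_centRepunit]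
    omega
  obtain ⟨c, hc⟩ := three_pow_dvd_centRepunit k
  have hc0 : 0 < c := Nat.pos_of_ne_zero fun h => by simp [h] at hc; omega
  have hfac : N = 2 * 3 ^ (k + 1) * (2 * c) := by rw [hN', hc]; ring
  have hdiv : N / (2 * 3 ^ (k + 1)) = 2 * c := by
    rw [hfac, Nat.mul_div_cancel_left _ (by positivity)]
  have hsum : (Nat.digits 10 N).sum = 3 * 3 ^ k := by
    rw [hN', digits_sum_twelve_mul_centRepunit]
  have hmul : 2 * c * (3 * 3 ^ k) = 6 * centRepunit (3 ^ k) := by rw [hc]; ring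
  refine ⟨⟨_, hfac⟩, by omega, ?_⟩
  rw [hdiv, hsum, hmul, ofDigits_reverse_digits_six_mul_centRepunit hpow, hN']
  ring
end

section
/- There exist infinitely many 10-Niven numbers all of whose decimal digits are nonzero; i.e., the set of positive integers N such that s_10(N) divides N and no base-10 digit of N equals 0 is infinite. -/
theorem nine_mul_ofDigits_replicate_one (n : ℕ) :
    9 * Nat.ofDigits 10 (List.replicate n 1) + 1 = 10 ^ n := by
  induction n with
  | zero => simp
  | succ n ih =>
    rw [List.replicate_succ, Nat.ofDigits_cons, pow_succ, ← ih]
    ring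

theorem digits_ofDigits_replicate_one (n : ℕ) :
    Nat.digits 10 (Nat.ofDigits 10 (List.replicate n 1)) = List.replicate n 1 := by
  refine Nat.digits_ofDigits 10 (by norm_num) _ (fun d hd => ?_) (fun h => ?_)
  · rw [List.eq_of_mem_replicate hd]
    norm_num
  · rw [List.getLast_replicate]
    norm_num

theorem three_pow_dvd_repunit (k : ℕ) :
    3 ^ k ∣ Nat.ofDigits 10 (List.replicate (3 ^ k) 1) := by
  induction k with
  | zero => simp
  | succ k ih =>
    have h := nine_mul_ofDigits_replicate_one (3 ^ k)
    have h' := nine_mul_ofDigits_replicate_one (3 ^ (k + 1))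
    rw [pow_succ 3 k, pow_mul, ← h, ← pow_succ 3 k] at h'
    set a := Nat.ofDigits 10 (List.replicate (3 ^ k) 1)
    have key : Nat.ofDigits 10 (List.replicate (3 ^ (k + 1)) 1) =
        a * 3 * (27 * a ^ 2 + 9 * a + 1) := by
      nlinarith
    rw [key, pow_succ]
    exact Dvd.dvd.mul_right (mul_dvd_mul_right ih 3) _

/-- There exist infinitely many 10-Niven numbers all of whose decimal digits
are nonzero: the set of positive integers `N` such that the decimal digit sum
of `N` divides `N` and no decimal digit of `N` equals `0` is infinite. -/
theorem stmt_2 :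
    {N : ℕ | 0 < N ∧ (Nat.digits 10 N).sum ∣ N ∧ 0 ∉ Nat.digits 10 N}.Infinite := by
  refine Set.infinite_of_injective_forall_mem
    (f := fun k : ℕ => Nat.ofDigits 10 (List.replicate (3 ^ k) 1)) (fun i j hij => ?_)
    (fun k => ⟨?_, ?_, ?_⟩)
  · have h := congrArg (fun N => (Nat.digits 10 N).length) hij
    simp only [digits_ofDigits_replicate_one, List.length_replicate] at h
    exact Nat.pow_right_injective (by norm_num) h
  · have h := nine_mul_ofDigits_replicate_one (3 ^ k)
    have h' : 1 < 10 ^ 3 ^ k := Nat.one_lt_pow (by positivity) (by norm_num)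
    omega
  · rw [digits_ofDigits_replicate_one]
    simpa using three_pow_dvd_repunit k
  · rw [digits_ofDigits_replicate_one]
    simp [List.mem_replicate]
end

section
/- Let b ≥ 2 be even, let p ≥ 1 be a natural number, and set k = b^p. Then the base-b repunit N_k = (b^k − 1)/(b − 1), whose base-b expansion consists of k digits all equal to 1, is a b-ARH number, and N_k is not a b-Niven number (s_b(N_k) = b^p does not divide N_k). -/
theorem ofDigits_replicate_one_mul (c n : ℕ) :
    Nat.ofDigits (c + 1) (List.replicate n 1) * c + 1 = (c + 1) ^ n := by
  induction n with
  | zero => simp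
  | succ n ih =>
    rw [List.replicate_succ, Nat.ofDigits_cons, pow_succ, ← ih]
    ring

theorem repunit_eq_ofDigits {b : ℕ} (hb : 2 ≤ b) (n : ℕ) :
    (b ^ n - 1) / (b - 1) = Nat.ofDigits b (List.replicate n 1) := by
  obtain ⟨c, rfl⟩ : ∃ c, b = c + 1 := ⟨b - 1, by omega⟩
  rw [← ofDigits_replicate_one_mul, Nat.add_sub_cancel, Nat.add_sub_cancel]
  exact Nat.mul_div_cancel _ (by omega)

theorem digits_ofDigits_replicate_zero_append_replicate_one {b : ℕ} (hb : 2 ≤ b) (m n : ℕ)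
    (hn : 0 < n) :
    Nat.digits b (Nat.ofDigits b (List.replicate m 0 ++ List.replicate n 1)) =
      List.replicate m 0 ++ List.replicate n 1 := by
  refine Nat.digits_ofDigits b (by omega) _ ?_ ?_
  · intro d hd
    rcases List.mem_append.1 hd with h | h <;> rw [List.eq_of_mem_replicate h] <;> omega
  · intro h
    rw [List.getLast_append_of_right_ne_nil _ _ (by simp; omega), List.getLast_replicate]
    exact one_ne_zero

/-- Let `b ≥ 2` be even, `p ≥ 1`, and `k = b ^ p`. Then the base-`b` repunit
`N_k = (b ^ k - 1) / (b - 1)` is a `b`-ARH number, and `N_k` is not a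
`b`-Niven number. -/
theorem stmt_3 (b p k N : ℕ) (hb : 2 ≤ b) (hbe : Even b) (hp : 1 ≤ p)
    (hk : k = b ^ p) (hN : N = (b ^ k - 1) / (b - 1)) :
    (∃ M : ℕ, 0 < M ∧
      N = M * (Nat.digits b N).sum +
        Nat.ofDigits b (Nat.digits b (M * (Nat.digits b N).sum)).reverse) ∧
    ¬ (Nat.digits b N).sum ∣ N := by
  have hb0 : 0 < b := by omega
  have hk0 : 0 < k := hk ▸ pow_pos hb0 p
  rw [repunit_eq_ofDigits hb] at hN
  have hsum : (Nat.digits b N).sum = k := by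
    have h := digits_ofDigits_replicate_zero_append_replicate_one hb 0 k hk0
    simp only [List.replicate_zero, List.nil_append, ← hN] at h
    simp [h]
  rw [hsum]
  constructor
  · obtain ⟨m, hm⟩ : Even k := hk ▸ hbe.pow_of_ne_zero (by omega)
    have hpm : p ≤ m := by
      have h1 : p - 1 < 2 ^ (p - 1) := Nat.lt_two_pow_self
      have h2 : 2 ^ p = 2 * 2 ^ (p - 1) := by rw [← pow_succ', Nat.sub_add_cancel hp]
      have h3 : 2 ^ p ≤ b ^ p := Nat.pow_le_pow_left hb p
      omega
    have hm0 : 0 < m := by omega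
    set R := Nat.ofDigits b (List.replicate m 1) with hR
    have hRpos : 0 < R := by
      have h := ofDigits_replicate_one_mul (b - 1) m
      rw [Nat.sub_add_cancel hb0, ← hR] at h
      have h1 : 1 < b ^ m := Nat.one_lt_pow (by omega) hb
      refine Nat.pos_of_ne_zero fun h0 => ?_
      rw [h0] at h
      omega
    have hA : b ^ (m - p) * R * k =
        Nat.ofDigits b (List.replicate m 0 ++ List.replicate m 1) := by
      rw [Nat.ofDigits_append, Nat.ofDigits_replicate_zero, List.length_replicate, zero_add, hk,
        ← hR, mul_right_comm, ← pow_add, Nat.sub_add_cancel hpm]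
    refine ⟨b ^ (m - p) * R, by positivity, ?_⟩
    rw [hA, digits_ofDigits_replicate_zero_append_replicate_one hb m m hm0, List.reverse_append,
      List.reverse_replicate, List.reverse_replicate, hN, hm, List.replicate_add]
    simp only [Nat.ofDigits_append, Nat.ofDigits_replicate_zero, List.length_replicate]
    ring
  · intro h
    have hbN : b ∣ N := (hk ▸ dvd_pow_self b (by omega)).trans h
    obtain ⟨j, rfl⟩ : ∃ j, k = j + 1 := ⟨k - 1, by omega⟩
    rw [hN, List.replicate_succ, Nat.ofDigits_cons, Nat.dvd_add_left (dvd_mul_right _ _)] at hbN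
    have := Nat.le_of_dvd one_pos (by simpa using hbN)
    omega
end

section
/- Let b ≥ 2 be even, let p ≥ 1 be a natural number, and set k = b^p. Then the base-b repunit N_k = (b^k − 1)/(b − 1) has at least 2^((k − 2p)/2) distinct additive multipliers; i.e., the set of positive integers M with N_k = M·s_b(N_k) + (M·s_b(N_k))^R has cardinality at least 2^((k − 2p)/2). -/
/-- The base-`b` value of `k` digits equal to `1` is the repunit. -/
theorem ofDigits_replicate_one {b : ℕ} (hb : 2 ≤ b) (k : ℕ) :
    Nat.ofDigits b (List.replicate k 1) = (b ^ k - 1) / (b - 1) := by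
  rw [← Nat.geomSum_eq hb]
  induction k with
  | zero => simp
  | succ k ih =>
    rw [List.replicate_succ, Nat.ofDigits_cons, ih, Finset.sum_range_succ', Finset.mul_sum]
    simp only [pow_succ', pow_zero]
    exact add_comm _ _

/-- Adding a string of bits to its complement gives a string of ones. -/
theorem ofDigits_add_ofDigits_map_compl (b : ℕ) {L : List ℕ} (hL : ∀ x ∈ L, x ≤ 1) :
    Nat.ofDigits b L + Nat.ofDigits b (L.map (1 - ·)) =
      Nat.ofDigits b (List.replicate L.length 1) := by
  induction L with
  | nil => simp
  | cons a L ih =>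
    have ha := hL a (by simp)
    have h := ih fun x hx => hL x (by simp [hx])
    simp only [List.map_cons, List.length_cons, List.replicate_succ, Nat.ofDigits_cons, ← h,
      mul_add]
    omega

theorem map_compl_map_compl {L : List ℕ} (hL : ∀ x ∈ L, x ≤ 1) :
    (L.map (1 - ·)).map (1 - ·) = L := by
  rw [List.map_map, List.map_congr_left (g := id) fun x hx => ?_, List.map_id]
  exact Nat.sub_sub_self (hL x hx)

/-- The bit string `l` followed by its reversed complement. -/
def antipalindrome (l : List ℕ) : List ℕ := l ++ (l.map (1 - ·)).reverse

theorem length_antipalindrome (l : List ℕ) :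
    (antipalindrome l).length = 2 * l.length := by
  simp [antipalindrome, two_mul]

theorem le_one_of_mem_antipalindrome {l : List ℕ} (hl : ∀ x ∈ l, x ≤ 1) :
    ∀ x ∈ antipalindrome l, x ≤ 1 := by
  intro x hx
  simp only [antipalindrome, List.mem_append, List.mem_reverse, List.mem_map] at hx
  rcases hx with hx | ⟨y, -, rfl⟩
  · exact hl x hx
  · omega

theorem reverse_antipalindrome {l : List ℕ} (hl : ∀ x ∈ l, x ≤ 1) :
    (antipalindrome l).reverse = (antipalindrome l).map (1 - ·) := by
  simp only [antipalindrome, List.reverse_append, List.reverse_reverse, List.map_append,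
    List.map_reverse, map_compl_map_compl hl]

theorem ofDigits_add_ofDigits_reverse_antipalindrome (b : ℕ) {l : List ℕ}
    (hl : ∀ x ∈ l, x ≤ 1) :
    Nat.ofDigits b (antipalindrome l) + Nat.ofDigits b (antipalindrome l).reverse =
      Nat.ofDigits b (List.replicate (2 * l.length) 1) := by
  rw [reverse_antipalindrome hl, ofDigits_add_ofDigits_map_compl b
    (le_one_of_mem_antipalindrome hl), length_antipalindrome]

theorem digits_ofDigits_antipalindrome {b : ℕ} (hb : 2 ≤ b) {l : List ℕ}
    (hl : ∀ x ∈ l, x ≤ 1) :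
    Nat.digits b (Nat.ofDigits b (antipalindrome (0 :: l))) = antipalindrome (0 :: l) := by
  refine Nat.digits_ofDigits b hb _ (fun x hx => ?_) (fun _ => ?_)
  · have := le_one_of_mem_antipalindrome (l := 0 :: l) (by simpa using hl) x hx
    omega
  · simp [antipalindrome]

/-- Distinct bit strings of the same length give distinct values of their antipalindromes. -/
theorem ofDigits_antipalindrome_injective {b : ℕ} (hb : 2 ≤ b) {l l' : List ℕ}
    (hlen : l.length = l'.length) (hl : ∀ x ∈ l, x ≤ 1) (hl' : ∀ x ∈ l', x ≤ 1)
    (h : Nat.ofDigits b (antipalindrome l) = Nat.ofDigits b (antipalindrome l')) : l = l' := by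
  have heq := Nat.ofDigits_inj_of_len_eq hb
    (by rw [length_antipalindrome, length_antipalindrome, hlen])
    (fun x hx => by have := le_one_of_mem_antipalindrome hl x hx; omega)
    (fun x hx => by have := le_one_of_mem_antipalindrome hl' x hx; omega) h
  exact (List.append_inj heq hlen).1

/-- The antipalindrome of a string starting with `p` zeros has value divisible by `b ^ p`. -/
theorem pow_dvd_ofDigits_antipalindrome (b p : ℕ) (l : List ℕ) :
    b ^ p ∣ Nat.ofDigits b (antipalindrome (List.replicate p 0 ++ l)) := by
  rw [antipalindrome, List.append_assoc, Nat.ofDigits_append, Nat.ofDigits_replicate_zero]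
  simp

/-- The bits of `f`, preceded by `p` zeros. -/
def paddedBits (p : ℕ) {n : ℕ} (f : Fin n → Fin 2) : List ℕ :=
  List.replicate p 0 ++ List.ofFn fun i => (f i : ℕ)

theorem le_one_of_mem_paddedBits (p : ℕ) {n : ℕ} (f : Fin n → Fin 2) :
    ∀ x ∈ paddedBits p f, x ≤ 1 := by
  intro x hx
  simp only [paddedBits, List.mem_append, List.mem_replicate, List.mem_ofFn] at hx
  rcases hx with ⟨-, rfl⟩ | ⟨i, rfl⟩ <;> omega

theorem length_paddedBits (p : ℕ) {n : ℕ} (f : Fin n → Fin 2) :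
    (paddedBits p f).length = p + n := by
  simp [paddedBits]

theorem paddedBits_injective (p n : ℕ) :
    Function.Injective (paddedBits p : (Fin n → Fin 2) → List ℕ) := by
  intro f g h
  have heq := List.ofFn_injective (List.append_cancel_left h)
  funext i
  exact Fin.ext (congrFun heq i)

theorem two_mul_le_pow {b p : ℕ} (hb : 2 ≤ b) (hp : 1 ≤ p) : 2 * p ≤ b ^ p := by
  obtain ⟨q, rfl⟩ := Nat.exists_eq_add_of_le' hp
  have h1 : q < 2 ^ q := Nat.lt_two_pow_self
  have h2 : 2 ^ (q + 1) ≤ b ^ (q + 1) := Nat.pow_le_pow_left hb _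
  rw [pow_succ] at h2
  omega


/-- Let `b ≥ 2` be even, `p ≥ 1`, and `k = b ^ p`. Then the base-`b` repunit
`N_k = (b ^ k - 1) / (b - 1)` has at least `2 ^ ((k - 2 * p) / 2)` distinct
additive multipliers: there is a finite set of that many positive integers `M`
with `N_k = M * s_b(N_k) + (M * s_b(N_k))^R`. -/
theorem stmt_4 (b p k N : ℕ) (hb : 2 ≤ b) (hbe : Even b) (hp : 1 ≤ p)
    (hk : k = b ^ p) (hN : N = (b ^ k - 1) / (b - 1)) :
    ∃ S : Finset ℕ, 2 ^ ((k - 2 * p) / 2) ≤ S.card ∧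
      ∀ M ∈ S, 0 < M ∧
        N = M * (Nat.digits b N).sum +
          Nat.ofDigits b (Nat.digits b (M * (Nat.digits b N).sum)).reverse := by
  obtain ⟨m, hm⟩ : Even k := hk ▸ hbe.pow_of_ne_zero (by omega)
  have hpk : 2 * p ≤ k := hk ▸ two_mul_le_pow hb hp
  set n := (k - 2 * p) / 2 with hn
  have hkn : 2 * (p + n) = k := by omega
  have hN1 : N = Nat.ofDigits b (List.replicate k 1) := by rw [hN, ofDigits_replicate_one hb]
  have hsum : (Nat.digits b N).sum = b ^ p := by
    rw [hN1, Nat.digits_ofDigits b hb _ (fun x hx => ?_) (fun _ => by simp)]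
    · simp [hk]
    · have := List.eq_of_mem_replicate hx
      omega
  rw [hsum]
  let X : (Fin n → Fin 2) → ℕ := fun f => Nat.ofDigits b (antipalindrome (paddedBits p f))
  have hX : ∀ f, X f / b ^ p * b ^ p = X f := fun f =>
    Nat.div_mul_cancel (pow_dvd_ofDigits_antipalindrome b p _)
  have hinj : Function.Injective fun f => X f / b ^ p := by
    intro f g h
    have heq : X f = X g := by rw [← hX f, ← hX g]; exact congrArg (· * b ^ p) h
    exact paddedBits_injective p n <| ofDigits_antipalindrome_injective hb
      (by simp only [length_paddedBits]) (le_one_of_mem_paddedBits p f)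
      (le_one_of_mem_paddedBits p g) heq
  refine ⟨Finset.univ.image fun f => X f / b ^ p, ?_, ?_⟩
  · rw [Finset.card_image_of_injective _ hinj]
    simp
  · intro M hM
    obtain ⟨f, -, rfl⟩ := Finset.mem_image.1 hM
    have hdig : Nat.digits b (X f) = antipalindrome (paddedBits p f) := by
      obtain ⟨q, rfl⟩ := Nat.exists_eq_add_of_le' hp
      have hf := le_one_of_mem_paddedBits q f
      exact digits_ofDigits_antipalindrome hb hf
    have hrev : N = X f + Nat.ofDigits b (Nat.digits b (X f)).reverse := by
      rw [hdig, ofDigits_add_ofDigits_reverse_antipalindrome b (le_one_of_mem_paddedBits p f),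
        length_paddedBits, hkn, hN1]
    refine ⟨Nat.pos_of_ne_zero fun h0 => ?_, by rw [hX]; exact hrev⟩
    have hX0 : X f = 0 := by rw [← hX f, h0, zero_mul]
    have hN0 : N = 0 := by simpa [hX0] using hrev
    rw [hN0] at hsum
    have : 0 < b ^ p := by positivity
    simp at hsum
    omega
end

section
/- Let b ≥ 2 be even, let p ≥ 1 be a natural number, and set k = b^p. Let N_k be the positive integer whose base-b digit string (from most significant to least significant digit) consists of p digits 1, followed by the two-digit block '10' repeated k − 2p times, followed by one digit 0, followed by p digits 1. Then N_k is a b-ARH number, N_k is not a b-Niven number, and the set of additive multipliers of N_k has cardinality at least (b − 1)^((k − 2p)/2). -/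
/-- The palindrome-like digit list `0, a₁, 0, a₂, …, 0, aₙ, 0, b - aₙ, 0, …, b - a₁, 0`. -/
def complementList (b : ℕ) : List ℕ → List ℕ
  | [] => [0]
  | a :: l => [0, a] ++ complementList b l ++ [b - a, 0]

theorem complementList_length (b : ℕ) (l : List ℕ) :
    (complementList b l).length = 4 * l.length + 1 := by
  induction l with
  | nil => rfl
  | cons a l ih =>
    simp only [complementList, List.length_append, List.length_cons, List.length_nil, ih]
    ring

theorem complementList_lt {b : ℕ} (hb : 0 < b) {l : List ℕ} (hl : ∀ a ∈ l, 0 < a ∧ a < b) :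
    ∀ d ∈ complementList b l, d < b := by
  induction l with
  | nil => simp [complementList, hb]
  | cons a l ih =>
    have ha := hl a (by simp)
    have ih := ih fun c hc => hl c (by simp [hc])
    intro d hd
    simp only [complementList, List.mem_append, List.mem_cons, List.not_mem_nil, or_false] at hd
    rcases hd with ((h | h) | h) | h | h
    · omega
    · omega
    · exact ih d h
    · omega
    · omega

theorem complementList_injective (b : ℕ) : Function.Injective (complementList b) := by
  intro l₁
  induction l₁ with
  | nil =>
    intro l₂ h
    have := congrArg List.length h
    simp only [complementList_length, List.length_nil] at this
    exact (List.length_eq_zero_iff.mp (by omega)).symm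
  | cons a l₁ ih =>
    intro l₂ h
    cases l₂ with
    | nil =>
      have := congrArg List.length h
      simp only [complementList_length, List.length_nil, List.length_cons] at this
      omega
    | cons c l₂ =>
      have hlen := congrArg List.length h
      simp only [complementList_length, List.length_cons] at hlen
      simp only [complementList, List.cons_append, List.nil_append,
        List.cons.injEq, true_and] at h
      obtain ⟨rfl, h⟩ := h
      rw [ih (List.append_inj_left h (by simp only [complementList_length]; omega))]

theorem ofDigits_complementList_add_reverse {b : ℕ} {l : List ℕ} (hl : ∀ a ∈ l, a < b) :
    Nat.ofDigits b (complementList b l) + Nat.ofDigits b (complementList b l).reverse =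
      b * ∑ j ∈ Finset.range (2 * l.length), b ^ (2 * j + 1) := by
  induction l with
  | nil => simp [complementList]
  | cons a l ih =>
    have ih := ih fun c hc => hl c (by simp [hc])
    obtain ⟨c, hc⟩ := Nat.exists_eq_add_of_le (hl a (by simp)).le
    have hc' : b - a = c := by omega
    have hsum : ∑ j ∈ Finset.range (2 * (a :: l).length), b ^ (2 * j + 1) =
        b + b ^ 2 * ∑ j ∈ Finset.range (2 * l.length), b ^ (2 * j + 1) +
          b ^ (4 * l.length + 3) := by
      rw [List.length_cons, show 2 * (l.length + 1) = 2 * l.length + 1 + 1 by ring,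
        Finset.sum_range_succ, Finset.sum_range_succ', Finset.mul_sum, add_comm b]
      congr 1
      · congr 1
        · exact Finset.sum_congr rfl fun j _ => by ring
        · simp
      · ring
    rw [hsum]
    simp only [complementList, hc', List.reverse_append, List.reverse_cons, List.reverse_nil,
      List.nil_append, List.cons_append, List.append_assoc, Nat.ofDigits_cons,
      Nat.ofDigits_append, Nat.ofDigits_nil, List.length_reverse, complementList_length]
    calc _ = b * (a + c) + b ^ 2 * (Nat.ofDigits b (complementList b l) +
          Nat.ofDigits b (complementList b l).reverse) + b ^ (4 * l.length + 3) * (a + c) := by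
          ring
      _ = _ := by rw [ih, ← hc]; ring

theorem length_flatten_replicate_one_zero (m : ℕ) :
    (List.replicate m [1, 0]).flatten.length = 2 * m := by
  simp [mul_comm]

theorem ofDigits_reverse_flatten_replicate_one_zero (b m : ℕ) :
    Nat.ofDigits b (List.replicate m [1, 0]).flatten.reverse =
      ∑ j ∈ Finset.range m, b ^ (2 * j + 1) := by
  induction m with
  | zero => simp
  | succ m ih =>
    rw [List.replicate_succ, List.flatten_cons, List.reverse_append, Nat.ofDigits_append, ih,
      List.length_reverse, length_flatten_replicate_one_zero, Finset.sum_range_succ]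
    simp [Nat.ofDigits_cons, pow_succ]

theorem digits_ofDigits_append_replicate_one {b p : ℕ} (hb : 2 ≤ b) (hp : 1 ≤ p) {l : List ℕ}
    (hl : ∀ d ∈ l, d < b) :
    Nat.digits b (Nat.ofDigits b (l ++ List.replicate p 1)) = l ++ List.replicate p 1 := by
  refine Nat.digits_ofDigits b hb _ ?_ ?_
  · intro d hd
    rcases List.mem_append.mp hd with h | h
    · exact hl d h
    · rw [List.eq_of_mem_replicate h]
      omega
  · intro h
    have hne : List.replicate p 1 ≠ [] := by
      simp only [ne_eq, List.replicate_eq_nil_iff]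
      omega
    rw [List.getLast_append_of_ne_nil h hne, List.getLast_replicate]
    exact one_ne_zero

/-- The integer whose digits, least significant first, are `complementList b l` followed by
`p` ones. -/
def complementMultiplier (b p : ℕ) (l : List ℕ) : ℕ :=
  Nat.ofDigits b (complementList b l ++ List.replicate p 1)

theorem complementMultiplier_mul_pow (b p : ℕ) (l : List ℕ) :
    complementMultiplier b p l * b ^ p =
      Nat.ofDigits b (List.replicate p 0 ++ complementList b l ++ List.replicate p 1) := by
  rw [complementMultiplier, List.append_assoc, Nat.ofDigits_append (l1 := List.replicate p 0),
    Nat.ofDigits_replicate_zero, List.length_replicate, zero_add, mul_comm]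

theorem complementMultiplier_pos {b p : ℕ} (hb : 2 ≤ b) (hp : 1 ≤ p) {l : List ℕ}
    (hl : ∀ a ∈ l, 0 < a ∧ a < b) : 0 < complementMultiplier b p l := by
  rw [Nat.pos_iff_ne_zero]
  intro h
  have hd := digits_ofDigits_append_replicate_one hb hp (complementList_lt (by omega) hl)
  rw [← complementMultiplier, h, Nat.digits_zero] at hd
  have := congrArg List.length hd
  simp only [List.length_nil, List.length_append, complementList_length] at this
  omega

theorem complementMultiplier_mul_pow_add_reverse {b p : ℕ} (hb : 2 ≤ b) (hp : 1 ≤ p)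
    {l : List ℕ} (hl : ∀ a ∈ l, 0 < a ∧ a < b) :
    complementMultiplier b p l * b ^ p +
        Nat.ofDigits b (Nat.digits b (complementMultiplier b p l * b ^ p)).reverse =
      Nat.ofDigits b (List.replicate p 1 ++ [0] ++
        (List.replicate (2 * l.length) [1, 0]).flatten.reverse ++ List.replicate p 1) := by
  have hlt : ∀ d ∈ List.replicate p 0 ++ complementList b l, d < b := by
    intro d hd
    rcases List.mem_append.mp hd with h | h
    · rw [List.eq_of_mem_replicate h]
      omega
    · exact complementList_lt (by omega) hl d h
  have key := ofDigits_complementList_add_reverse fun a ha => (hl a ha).2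
  rw [complementMultiplier_mul_pow, digits_ofDigits_append_replicate_one hb hp hlt]
  simp only [List.reverse_append, List.reverse_replicate, Nat.ofDigits_append,
    Nat.ofDigits_replicate_zero, List.length_append, List.length_replicate, List.length_reverse,
    complementList_length, length_flatten_replicate_one_zero,
    ofDigits_reverse_flatten_replicate_one_zero, List.length_singleton, Nat.ofDigits_singleton]
  set r := Nat.ofDigits b (List.replicate p 1)
  calc _ = r + b ^ p * (Nat.ofDigits b (complementList b l) +
        Nat.ofDigits b (complementList b l).reverse) + b ^ (p + (4 * l.length + 1)) * r := by ring
    _ = _ := by rw [key]; ring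

theorem exists_finset_complementMultiplier {b p : ℕ} (hb : 2 ≤ b) (hp : 1 ≤ p) (n : ℕ) :
    ∃ S : Finset ℕ, S.card = (b - 1) ^ n ∧
      ∀ M ∈ S, ∃ l : List ℕ, l.length = n ∧ (∀ a ∈ l, 0 < a ∧ a < b) ∧
        M = complementMultiplier b p l := by
  let L : (Fin n → Fin (b - 1)) → List ℕ := fun g => List.ofFn fun i => (g i : ℕ) + 1
  have hL : ∀ g, ∀ a ∈ L g, 0 < a ∧ a < b := by
    intro g a ha
    obtain ⟨i, rfl⟩ := (List.mem_ofFn' _ _).mp ha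
    have := (g i).isLt
    dsimp only
    omega
  have hinj : Function.Injective fun g => complementMultiplier b p (L g) := by
    intro g₁ g₂ h
    have hd := congrArg (Nat.digits b) h
    simp only [complementMultiplier] at hd
    rw [digits_ofDigits_append_replicate_one hb hp (complementList_lt (by omega) (hL g₁)),
      digits_ofDigits_append_replicate_one hb hp (complementList_lt (by omega) (hL g₂))] at hd
    have hl := complementList_injective b (List.append_cancel_right hd)
    funext i
    have := congrFun (List.ofFn_injective hl) i
    exact Fin.ext (by simpa using this)
  refine ⟨Finset.univ.image fun g => complementMultiplier b p (L g), ?_, ?_⟩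
  · simp [Finset.card_image_of_injective _ hinj]
  · intro M hM
    obtain ⟨g, -, rfl⟩ := Finset.mem_image.mp hM
    exact ⟨L g, by simp [L], hL g, rfl⟩

theorem not_pow_dvd_ofDigits_replicate_one_append {b p : ℕ} (hb : 2 ≤ b) (hp : 1 ≤ p)
    (l : List ℕ) : ¬ b ^ p ∣ Nat.ofDigits b (List.replicate p 1 ++ l) := by
  intro h
  have hdvd : b ∣ Nat.ofDigits b (List.replicate p 1 ++ l) :=
    (dvd_pow_self b (by omega)).trans h
  obtain ⟨q, rfl⟩ := Nat.exists_eq_add_of_le' hp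
  rw [List.replicate_succ, List.cons_append, Nat.ofDigits_cons,
    Nat.dvd_add_left (dvd_mul_right _ _), Nat.dvd_one] at hdvd
  omega


/-- Let `b ≥ 2` be even, `p ≥ 1`, and `k = b ^ p`. Let `N_k` be the positive
integer whose base-`b` digit string (most significant digit first) consists of
`p` digits `1`, followed by the block `10` repeated `k - 2 * p` times, followed
by one digit `0`, followed by `p` digits `1`. Then `N_k` is a `b`-ARH number,
`N_k` is not a `b`-Niven number, and `N_k` has at least
`(b - 1) ^ ((k - 2 * p) / 2)` distinct additive multipliers. -/
theorem stmt_5 (b p k N : ℕ) (hb : 2 ≤ b) (hbe : Even b) (hp : 1 ≤ p)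
    (hk : k = b ^ p)
    (hN : N = Nat.ofDigits b
      (List.replicate p 1 ++ (List.replicate (k - 2 * p) [1, 0]).flatten ++
        [0] ++ List.replicate p 1).reverse) :
    (∃ M : ℕ, 0 < M ∧
      N = M * (Nat.digits b N).sum +
        Nat.ofDigits b (Nat.digits b (M * (Nat.digits b N).sum)).reverse) ∧
    ¬ (Nat.digits b N).sum ∣ N ∧
    ∃ S : Finset ℕ, (b - 1) ^ ((k - 2 * p) / 2) ≤ S.card ∧
      ∀ M ∈ S, 0 < M ∧
        N = M * (Nat.digits b N).sum +
          Nat.ofDigits b (Nat.digits b (M * (Nat.digits b N).sum)).reverse := by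
  obtain ⟨n, hn⟩ : ∃ n, k - 2 * p = 2 * n := by
    have hke : Even k := hk ▸ hbe.pow_of_ne_zero (by omega)
    exact even_iff_exists_two_mul.mp (by grind)
  have hpk : 2 * p ≤ k := hk ▸ two_mul_le_pow hb hp
  have hN' : N = Nat.ofDigits b (List.replicate p 1 ++ [0] ++
      (List.replicate (2 * n) [1, 0]).flatten.reverse ++ List.replicate p 1) := by
    rw [hN, hn]
    simp only [List.reverse_append, List.reverse_replicate, List.append_assoc,
      List.reverse_singleton]
  have hsum : (Nat.digits b N).sum = b ^ p := by
    rw [hN', digits_ofDigits_append_replicate_one hb hp]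
    · simp only [List.sum_append, List.sum_reverse, List.sum_replicate, List.sum_flatten,
        List.map_replicate, List.sum_cons, List.sum_nil, smul_eq_mul]
      omega
    · intro d hd
      simp only [List.mem_append, List.mem_replicate, List.mem_singleton, List.mem_reverse,
        List.mem_flatten] at hd
      rcases hd with (h | h) | ⟨t, ⟨-, rfl⟩, h⟩
      · omega
      · omega
      · simp only [List.mem_cons, List.not_mem_nil, or_false] at h
        omega
  obtain ⟨S, hcard, hS⟩ := exists_finset_complementMultiplier hb hp n
  have hmul : ∀ M ∈ S, 0 < M ∧
      N = M * (Nat.digits b N).sum +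
        Nat.ofDigits b (Nat.digits b (M * (Nat.digits b N).sum)).reverse := by
    intro M hM
    obtain ⟨l, rfl, hl, rfl⟩ := hS M hM
    rw [hsum, complementMultiplier_mul_pow_add_reverse hb hp hl]
    exact ⟨complementMultiplier_pos hb hp hl, hN'⟩
  refine ⟨?_, ?_, S, ?_, hmul⟩
  · have hpos : 0 < S.card := hcard ▸ Nat.pow_pos (by omega)
    obtain ⟨M, hM⟩ := Finset.card_pos.mp hpos
    exact ⟨M, hmul M hM⟩
  · rw [hsum, hN', List.append_assoc, List.append_assoc]
    exact not_pow_dvd_ofDigits_replicate_one_append hb hp _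
  · rw [hcard, hn, Nat.mul_div_cancel_left n two_pos]
end

section
/- If b ≥ 2 is even, then there exist infinitely many additive multipliers in base b; i.e., the set of positive integers M such that M is an additive multiplier of some positive integer N is infinite. -/
/-- If `b ≥ 2` is even, there exist infinitely many additive multipliers in
base `b`: the set of positive integers `M` such that `M` is an additive
multiplier of some positive integer `N` is infinite. -/
theorem stmt_6 (b : ℕ) (hb : 2 ≤ b) (hbe : Even b) :
    {M : ℕ | 0 < M ∧ ∃ N : ℕ, 0 < N ∧
      N = M * (Nat.digits b N).sum +
        Nat.ofDigits b (Nat.digits b (M * (Nat.digits b N).sum)).reverse}.Infinite := by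
  obtain ⟨m, rfl⟩ := hbe
  set b := m + m with hbm
  set L : List ℕ := List.replicate m 1 with hL
  set R := Nat.ofDigits b L with hR
  have hL0 : L ≠ [] := by rw [hL, Ne, List.replicate_eq_nil_iff]; omega
  have digits_eq (l : List ℕ) (hl : ∀ d ∈ l, d = 0 ∨ d = 1) :
      Nat.digits b (Nat.ofDigits b (l ++ L)) = l ++ L := by
    refine Nat.digits_ofDigits b (by omega) _ (fun d hd => ?_) (fun h => ?_)
    · rcases List.mem_append.1 hd with h | h
      · rcases hl d h with rfl | rfl <;> omega
      · rw [List.eq_of_mem_replicate h]; omega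
    · rw [List.getLast_append_of_ne_nil _ hL0]
      simp [hL]
  have digits_R : Nat.digits b R = L := digits_eq [] (by simp)
  have hRpos : 0 < R := by
    rw [Nat.pos_iff_ne_zero]
    intro h
    rw [h, Nat.digits_zero] at digits_R
    exact hL0 digits_R.symm
  have ofDigits_zeros (n : ℕ) : Nat.ofDigits b (List.replicate n 0) = 0 := by
    induction n with
    | zero => simp
    | succ n ih => simp [List.replicate_succ, Nat.ofDigits_cons, ih]
  refine Set.infinite_of_injective_forall_mem (f := fun k : ℕ => b ^ (m + k) * R) ?_ ?_
  · intro i j h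
    have := Nat.pow_right_injective hb (Nat.eq_of_mul_eq_mul_right hRpos h)
    omega
  · intro k
    refine ⟨by positivity, b ^ (m + k + 1) * R + R, by positivity, ?_⟩
    have hN : b ^ (m + k + 1) * R + R =
        Nat.ofDigits b ((L ++ List.replicate (k + 1) 0) ++ L) := by
      simp only [Nat.ofDigits_append, ofDigits_zeros, List.length_append,
        List.length_replicate, hL, hR]
      ring
    have hA : b ^ (m + k) * R * b =
        Nat.ofDigits b (List.replicate (m + k + 1) 0 ++ L) := by
      simp only [Nat.ofDigits_append, ofDigits_zeros, List.length_replicate, ← hR]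
      ring
    have hsum : (Nat.digits b (b ^ (m + k + 1) * R + R)).sum = b := by
      rw [hN, digits_eq]
      · simp [hL, hbm]
      · intro d hd
        rcases List.mem_append.1 hd with h | h
        · exact Or.inr (List.eq_of_mem_replicate h)
        · exact Or.inl (List.eq_of_mem_replicate h)
    have hrev : L.reverse = L := List.reverse_replicate
    rw [hsum, hA, digits_eq _ (fun d hd => Or.inl (List.eq_of_mem_replicate hd)), ← hA,
      List.reverse_append, hrev, List.reverse_replicate, Nat.ofDigits_append,
      ofDigits_zeros, ← hR]
    ring
end

section
/- Let b ≥ 2 be a base, let n ≥ 1 be a positive integer not divisible by b − 1, and set R_n = (b^n − 1)/(b − 1). Then (b − 1)·n·R_n is a b-Niven number but is not a b-MRH number. -/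
theorem sum_digits_eq_mod_add_sum_digits_div {b : ℕ} (hb : 2 ≤ b) (m : ℕ) :
    (Nat.digits b m).sum = m % b + (Nat.digits b (m / b)).sum := by
  rcases Nat.eq_zero_or_pos m with rfl | hm
  · simp
  · rw [Nat.digits_def' (by omega) hm, List.sum_cons]

/-- If `x = m * b ^ k + (b ^ k - 1 - r)` with `r < b ^ k`, then the low digits of `x` are the
complements of the digits of `r` and the high digits of `x` are those of `m`. -/
theorem sum_digits_add_sum_digits_of_complement {b : ℕ} (hb : 2 ≤ b) (k : ℕ) (x r m : ℕ)
    (hr : r < b ^ k) (h : x + r + 1 = b ^ k * (m + 1)) :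
    (Nat.digits b x).sum + (Nat.digits b r).sum = (Nat.digits b m).sum + (b - 1) * k := by
  induction k generalizing x r with
  | zero =>
    obtain rfl : r = 0 := by simpa using hr
    obtain rfl : x = m := by simpa using h
    simp
  | succ k ih =>
    have hx := Nat.div_add_mod x b
    have hr' := Nat.div_add_mod r b
    have hxlt : x % b < b := Nat.mod_lt _ (by omega)
    have hrlt : r % b < b := Nat.mod_lt _ (by omega)
    have hdvd : b ∣ x % b + r % b + 1 := by
      have hsum : b ∣ b * (x / b + r / b) + (x % b + r % b + 1) :=
        ⟨b ^ k * (m + 1), by rw [← mul_assoc, ← pow_succ', ← h]; linarith⟩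
      exact (Nat.dvd_add_right (dvd_mul_right _ _)).mp hsum
    have hlow : x % b + r % b + 1 = b := by
      obtain ⟨c, hc⟩ := hdvd
      have hc2 : c < 2 := by
        by_contra! hc2
        have := Nat.mul_le_mul_left b hc2
        omega
      interval_cases c <;> omega
    have hhigh : x / b + r / b + 1 = b ^ k * (m + 1) := by
      apply Nat.eq_of_mul_eq_mul_left (show 0 < b by omega)
      rw [← mul_assoc, ← pow_succ', ← h]
      linarith
    have := ih (x / b) (r / b)
      (Nat.div_lt_of_lt_mul (by rwa [pow_succ'] at hr)) hhigh
    rw [sum_digits_eq_mod_add_sum_digits_div hb x, sum_digits_eq_mod_add_sum_digits_div hb r,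
      Nat.mul_succ]
    omega

theorem sum_digits_mul_pow_sub_one {b n : ℕ} (hb : 2 ≤ b) (hn : 1 ≤ n) :
    (Nat.digits b (n * (b ^ n - 1))).sum = (b - 1) * n := by
  have hlt : n < b ^ n := Nat.lt_pow_self (by omega)
  have := sum_digits_add_sum_digits_of_complement hb n (n * (b ^ n - 1)) (n - 1) (n - 1)
    (by omega) (by
      rw [Nat.sub_add_cancel hn, add_assoc, Nat.sub_add_cancel hn, ← Nat.mul_succ,
        Nat.succ_eq_add_one, Nat.sub_add_cancel (by omega), mul_comm])
  omega

theorem modEq_ofDigits_reverse_digits {b : ℕ} (hb : 2 ≤ b) (x : ℕ) :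
    Nat.ofDigits b (Nat.digits b x).reverse ≡ x [MOD (b - 1)] := by
  have hb1 : b ≡ 1 [MOD (b - 1)] :=
    ((Nat.modEq_iff_dvd' (by omega)).mpr dvd_rfl).symm
  have h := Nat.ofDigits_modEq' b 1 (b - 1) hb1
  have h1 := h (Nat.digits b x).reverse
  have h2 := h (Nat.digits b x)
  rw [Nat.ofDigits_one, List.sum_reverse] at h1
  rw [Nat.ofDigits_one, Nat.ofDigits_digits] at h2
  exact h1.trans h2.symm

theorem repunit_modEq {b : ℕ} (hb : 2 ≤ b) (n : ℕ) :
    (b ^ n - 1) / (b - 1) ≡ n [MOD (b - 1)] := by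
  have hb1 : b ≡ 1 [MOD (b - 1)] :=
    ((Nat.modEq_iff_dvd' (by omega)).mpr dvd_rfl).symm
  rw [← Nat.geomSum_eq hb]
  induction n with
  | zero => simp; rfl
  | succ n ih =>
    rw [Finset.sum_range_succ]
    exact ih.add (by simpa using hb1.pow n)

/-- Let `b ≥ 2`, let `n ≥ 1` not be divisible by `b - 1`, and set
`R_n = (b ^ n - 1) / (b - 1)`. Then `(b - 1) * n * R_n` is a `b`-Niven number
but is not a `b`-MRH number. -/
theorem stmt_8 (b n N : ℕ) (hb : 2 ≤ b) (hn : 1 ≤ n) (hnd : ¬ (b - 1) ∣ n)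
    (hN : N = (b - 1) * n * ((b ^ n - 1) / (b - 1))) :
    (Nat.digits b N).sum ∣ N ∧
    ¬ ∃ M : ℕ, 0 < M ∧
      N = M * (Nat.digits b N).sum *
        Nat.ofDigits b (Nat.digits b (M * (Nat.digits b N).sum)).reverse := by
  have hs : (Nat.digits b N).sum = (b - 1) * n := by
    have hN' : N = n * (b ^ n - 1) := by
      rw [hN, mul_comm (b - 1) n, mul_assoc, Nat.mul_div_cancel' (Nat.sub_one_dvd_pow_sub_one b n)]
    rw [hN', sum_digits_mul_pow_sub_one hb hn]
  rw [hs]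
  refine ⟨⟨_, hN⟩, ?_⟩
  rintro ⟨M, -, hM⟩
  set Y := Nat.ofDigits b (Nat.digits b (M * ((b - 1) * n))).reverse
  have hRM : (b ^ n - 1) / (b - 1) = M * Y := by
    apply Nat.eq_of_mul_eq_mul_left (show 0 < (b - 1) * n from Nat.mul_pos (by omega) hn)
    rw [← hN, hM]
    ring
  have hdvdY : (b - 1) ∣ Y :=
    ((modEq_ofDigits_reverse_digits hb _).dvd_iff dvd_rfl).mpr
      ((dvd_mul_right _ n).mul_left M)
  exact hnd (((repunit_modEq hb n).dvd_iff dvd_rfl).mp (hRM ▸ hdvdY.mul_left M))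
end

section
/- Let b ≥ 2 be a base, let n ≥ 1, and set R_n = (b^n − 1)/(b − 1). For every positive integer m with m ≤ (b − 1)·R_n, the sum of the base-b digits of (b − 1)·m·R_n equals (b − 1)·n. -/
theorem sum_digits_add_mul {b c : ℕ} (hb : 1 < b) (hc : c < b) (q : ℕ) :
    (Nat.digits b (c + b * q)).sum = c + (Nat.digits b q).sum := by
  by_cases h : c = 0 ∧ q = 0
  · simp [h.1, h.2]
  · rw [Nat.digits_add b hb c q hc (by tauto), List.sum_cons]

theorem sum_digits_add_pow_mul {b : ℕ} (hb : 1 < b) (n : ℕ) {r : ℕ} (hr : r < b ^ n) (q : ℕ) :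
    (Nat.digits b (r + b ^ n * q)).sum = (Nat.digits b r).sum + (Nat.digits b q).sum := by
  induction n generalizing r with
  | zero =>
    obtain rfl : r = 0 := by simpa using hr
    simp
  | succ n ih =>
    have hc : r % b < b := Nat.mod_lt _ (by lia)
    have hdiv : r / b < b ^ n := Nat.div_lt_of_lt_mul (by rwa [pow_succ'] at hr)
    have hsplit : r + b ^ (n + 1) * q = r % b + b * (r / b + b ^ n * q) := by
      conv_lhs => rw [← Nat.mod_add_div r b]
      ring
    have hsum := sum_digits_add_mul hb hc (r / b)
    rw [Nat.mod_add_div] at hsum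
    rw [hsplit, sum_digits_add_mul hb hc, ih hdiv, hsum, add_assoc]

theorem sum_digits_add_sum_digits_complement {b : ℕ} (hb : 1 < b) (n : ℕ) {k l : ℕ}
    (h : k + l + 1 = b ^ n) :
    (Nat.digits b k).sum + (Nat.digits b l).sum = (b - 1) * n := by
  induction n generalizing k l with
  | zero =>
    obtain ⟨rfl, rfl⟩ : k = 0 ∧ l = 0 := by simpa using h
    simp
  | succ n ih =>
    have hc : k % b < b := Nat.mod_lt _ (by lia)
    have hd : l % b < b := Nat.mod_lt _ (by lia)
    have hk := Nat.mod_add_div k b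
    have hl := Nat.mod_add_div l b
    have heq : (k % b + l % b + 1) + b * (k / b + l / b) = b * b ^ n := by
      rw [← pow_succ', ← h]
      linarith
    have hdvd : b ∣ k % b + l % b + 1 :=
      (Nat.dvd_add_left (dvd_mul_right b _)).mp (heq ▸ dvd_mul_right b _)
    have hlast : k % b + l % b + 1 = b := by
      obtain ⟨t, ht⟩ := hdvd
      have ht2 : t < 2 := by
        by_contra! h2
        have := Nat.mul_le_mul_left b h2
        lia
      interval_cases t <;> lia
    have hrest : k / b + l / b + 1 = b ^ n := by
      apply Nat.eq_of_mul_eq_mul_left (by lia : 0 < b)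
      rw [← heq, hlast]
      ring
    have hsk := sum_digits_add_mul hb hc (k / b)
    have hsl := sum_digits_add_mul hb hd (l / b)
    rw [hk] at hsk
    rw [hl] at hsl
    have := ih hrest
    rw [hsk, hsl, mul_add, mul_one]
    lia

/-- Let `b ≥ 2`, `n ≥ 1`, and `R_n = (b ^ n - 1) / (b - 1)`. For every positive
integer `m` with `m ≤ (b - 1) * R_n`, the sum of the base-`b` digits of
`(b - 1) * m * R_n` equals `(b - 1) * n`. -/
theorem stmt_9 (b n m : ℕ) (hb : 2 ≤ b) (hn : 1 ≤ n) (hm : 1 ≤ m)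
    (hle : m ≤ (b - 1) * ((b ^ n - 1) / (b - 1))) :
    (Nat.digits b ((b - 1) * m * ((b ^ n - 1) / (b - 1)))).sum = (b - 1) * n := by
  have hR : (b - 1) * ((b ^ n - 1) / (b - 1)) = b ^ n - 1 :=
    Nat.mul_div_cancel' (Nat.sub_one_dvd_pow_sub_one b n)
  rw [mul_right_comm, hR]
  rw [hR] at hle
  obtain ⟨k, rfl⟩ := Nat.exists_eq_add_of_le' hm
  obtain ⟨l, hl⟩ := Nat.exists_eq_add_of_le (Nat.le_of_succ_le hle)
  have hpow : l + k + 1 = b ^ n := by omega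
  have hsplit : (b ^ n - 1) * (k + 1) = l + b ^ n * k := by
    rw [← hpow, Nat.add_sub_cancel]
    ring
  rw [hsplit, sum_digits_add_pow_mul hb n (by omega),
    sum_digits_add_sum_digits_complement hb n hpow]
end

section
/- For every base b ≥ 2, there exist infinitely many positive integers that are not b-ARH numbers; i.e., the set of positive integers N for which no positive integer M satisfies N = M·s_b(N) + (M·s_b(N))^R is infinite. -/
/-- A power of `b` with exponent at least two is not the sum of a number and its base-`b` reversal. -/
theorem pow_ne_add_ofDigits_reverse_digits {b n : ℕ} (hb : 2 ≤ b) (hn : 2 ≤ n) (X : ℕ) :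
    b ^ n ≠ X + Nat.ofDigits b (Nat.digits b X).reverse := by
  intro h
  have hX : X = Nat.ofDigits b (Nat.digits b X) := (Nat.ofDigits_digits b X).symm
  have hlt : ∀ d ∈ Nat.digits b X, d < b := fun d hd => Nat.digits_lt_base (by omega) hd
  have hlast : ∀ hne : Nat.digits b X ≠ [], (Nat.digits b X).getLast hne ≠ 0 := fun hne =>
    Nat.getLast_digit_ne_zero b (Nat.digits_ne_nil_iff_ne_zero.mp hne)
  generalize Nat.digits b X = L at h hX hlt hlast
  subst hX
  have hbn : b * b ≤ b ^ n := by
    rw [← pow_two]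
    exact Nat.pow_le_pow_right (by omega) hn
  induction L using List.bidirectionalRec with
  | nil =>
    simp at h
    omega
  | singleton a =>
    have ha := hlt a (by simp)
    simp at h
    nlinarith
  | cons_append a l c _ =>
    have ha := hlt a (by simp)
    have hc := hlt c (by simp)
    have hc0 : c ≠ 0 := by simpa using hlast (by simp)
    have hX := Nat.ofDigits_lt_base_pow_length (b := b) (by omega) hlt
    have hR := Nat.ofDigits_lt_base_pow_length (b := b) (l := (a :: (l ++ [c])).reverse)
      (by omega) (fun d hd => hlt d (List.mem_reverse.mp hd))
    have hsum : b ^ n = (a + c) + b * (Nat.ofDigits b l + Nat.ofDigits b l.reverse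
        + b ^ l.length * (a + c)) := by
      rw [h]
      simp [Nat.ofDigits_cons, Nat.ofDigits_append]
      ring
    have hdvd : b ∣ a + c :=
      (Nat.dvd_add_left (dvd_mul_right b _)).mp (hsum ▸ dvd_pow_self b (by omega))
    have hac : a + c = b := by
      obtain ⟨k, hk⟩ := hdvd
      have h1 : k < 2 := by
        by_contra! hk2
        nlinarith
      interval_cases k <;> omega
    have hlen : (a :: (l ++ [c])).length = l.length + 2 := by simp
    rw [List.length_reverse, hlen] at hR
    rw [hlen] at hX
    have hgt : b ^ (l.length + 2) < b ^ n := by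
      rw [hsum, hac, pow_add, pow_two]
      nlinarith [Nat.zero_le (b * (Nat.ofDigits b l + Nat.ofDigits b l.reverse))]
    have hexp : l.length + 3 ≤ n := (Nat.pow_lt_pow_iff_right (by omega)).mp hgt
    have hge : b ^ (l.length + 2) * b ≤ b ^ n := by
      rw [← pow_succ]
      exact Nat.pow_le_pow_right (by omega) hexp
    nlinarith

/-- For every base `b ≥ 2`, there exist infinitely many positive integers that
are not `b`-ARH numbers: the set of positive integers `N` for which no positive
integer `M` satisfies `N = M * s_b(N) + (M * s_b(N))^R` is infinite. -/
theorem stmt_10 (b : ℕ) (hb : 2 ≤ b) :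
    {N : ℕ | 0 < N ∧ ¬ ∃ M : ℕ, 0 < M ∧
      N = M * (Nat.digits b N).sum +
        Nat.ofDigits b (Nat.digits b (M * (Nat.digits b N).sum)).reverse}.Infinite := by
  refine Set.infinite_of_injective_forall_mem (f := fun n : ℕ => b ^ (n + 2)) ?_ ?_
  · intro m n hmn
    simpa using Nat.pow_right_injective hb hmn
  · rintro n
    refine ⟨by positivity, ?_⟩
    rintro ⟨M, -, hM⟩
    exact pow_ne_add_ofDigits_reverse_digits hb (by omega) _ hM
end

section
/- Let b ≥ 3 be odd and let k ≥ 2. Set m = b^(2^(k−1)) − 1 and N_k = m². Then s_b(N_k) = 2^(k−1)·(b − 1) = s_b(m), and N_k is a b-MRH number. -/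
theorem ofDigits_replicate_pred (c n : ℕ) :
    Nat.ofDigits (c + 1) (List.replicate n c) + 1 = (c + 1) ^ n := by
  induction n with
  | zero => simp
  | succ n ih =>
    rw [List.replicate_succ, Nat.ofDigits_cons, pow_succ, ← ih]
    ring

theorem ofDigits_replicate_zero (b n : ℕ) : Nat.ofDigits b (List.replicate n 0) = 0 := by
  induction n with
  | zero => simp
  | succ n ih => simp [List.replicate_succ, Nat.ofDigits_cons, ih]

theorem digits_pow_sub_one {c : ℕ} (hc : 0 < c) (n : ℕ) :
    Nat.digits (c + 1) ((c + 1) ^ n - 1) = List.replicate n c := by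
  rw [← ofDigits_replicate_pred, Nat.add_sub_cancel]
  apply Nat.digits_ofDigits _ (by omega)
  · intro l hl
    rw [List.eq_of_mem_replicate hl]
    omega
  · intro h
    rw [List.eq_of_mem_replicate (List.getLast_mem h)]
    omega

/-- In base `c + 1`, the number `((c + 1) ^ n - 1) ^ 2` has digits, from the lowest one up:
`1`, then `n - 1` zeros, then `c - 1`, then `n - 1` times `c`. -/
theorem digits_sq_pow_sub_one {c : ℕ} (hc : 2 ≤ c) (p : ℕ) :
    Nat.digits (c + 1) (((c + 1) ^ (p + 1) - 1) ^ 2) =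
      (1 :: List.replicate p 0) ++ ((c - 1) :: List.replicate p c) := by
  obtain ⟨d, rfl⟩ : ∃ d, c = d + 1 := ⟨c - 1, by omega⟩
  have key : ((d + 1 + 1) ^ (p + 1) - 1) ^ 2 = Nat.ofDigits (d + 1 + 1)
      ((1 :: List.replicate p 0) ++ ((d + 1 - 1) :: List.replicate p (d + 1))) := by
    have h := ofDigits_replicate_pred (d + 1) p
    rw [Nat.ofDigits_append, Nat.ofDigits_cons, Nat.ofDigits_cons, ofDigits_replicate_zero]
    simp only [List.length_cons, List.length_replicate, Nat.add_sub_cancel]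
    generalize Nat.ofDigits (d + 1 + 1) (List.replicate p (d + 1)) = x at h ⊢
    have h' : (d + 1 + 1) ^ (p + 1) - 1 = (d + 1 + 1) * x + (d + 1) := by
      rw [pow_succ, ← h]
      exact Nat.sub_eq_of_eq_add (by ring)
    rw [h', pow_succ _ p, ← h]
    ring
  rw [key]
  apply Nat.digits_ofDigits _ (by omega)
  · intro l hl
    simp only [List.mem_append, List.mem_cons, List.mem_replicate] at hl
    omega
  · intro h
    rw [List.getLast_append_of_ne_nil _ (List.cons_ne_nil _ _)]
    have hl := List.getLast_mem (List.cons_ne_nil (d + 1 - 1) (List.replicate p (d + 1)))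
    simp only [List.mem_cons, List.mem_replicate] at hl
    omega

theorem two_pow_mul_pred_dvd_pow_sub_one {b : ℕ} (hb : Odd b) (j : ℕ) :
    2 ^ j * (b - 1) ∣ b ^ 2 ^ j - 1 := by
  induction j with
  | zero => simp
  | succ j ih =>
    have h : b ^ 2 ^ (j + 1) - 1 = (b ^ 2 ^ j + 1) * (b ^ 2 ^ j - 1) := by
      rw [pow_succ 2 j, pow_mul, ← Nat.sq_sub_sq, one_pow]
    have h2 : 2 ∣ b ^ 2 ^ j + 1 := (hb.pow.add_odd odd_one).two_dvd
    rw [h, pow_succ', mul_assoc]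
    exact mul_dvd_mul h2 ih

/-- Let `b ≥ 3` be odd and `k ≥ 2`. Set `m = b ^ (2 ^ (k - 1)) - 1` and
`N_k = m ^ 2`. Then `s_b(N_k) = 2 ^ (k - 1) * (b - 1) = s_b(m)`, and `N_k` is a
`b`-MRH number. -/
theorem stmt_11 (b k m N : ℕ) (hb : 3 ≤ b) (hbo : Odd b) (hk : 2 ≤ k)
    (hm : m = b ^ (2 ^ (k - 1)) - 1) (hN : N = m ^ 2) :
    (Nat.digits b N).sum = 2 ^ (k - 1) * (b - 1) ∧
    (Nat.digits b m).sum = 2 ^ (k - 1) * (b - 1) ∧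
    ∃ M : ℕ, 0 < M ∧
      N = M * (Nat.digits b N).sum *
        Nat.ofDigits b (Nat.digits b (M * (Nat.digits b N).sum)).reverse := by
  obtain ⟨M, hM⟩ := two_pow_mul_pred_dvd_pow_sub_one hbo (k - 1)
  obtain ⟨c, rfl⟩ : ∃ c, b = c + 1 := ⟨b - 1, by omega⟩
  have hpos : 0 < 2 ^ (k - 1) := by positivity
  have hdm : Nat.digits (c + 1) m = List.replicate (2 ^ (k - 1)) c := by
    rw [hm, digits_pow_sub_one (by omega)]
  have hsN : (Nat.digits (c + 1) N).sum = 2 ^ (k - 1) * (c + 1 - 1) := by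
    obtain ⟨p, hp⟩ : ∃ p, 2 ^ (k - 1) = p + 1 := ⟨2 ^ (k - 1) - 1, by omega⟩
    rw [hN, hm, hp, digits_sq_pow_sub_one (by omega)]
    simp only [List.sum_append, List.sum_cons, List.sum_replicate, smul_eq_mul, mul_zero,
      Nat.add_sub_cancel, add_mul, one_mul]
    omega
  have hMm : M * (2 ^ (k - 1) * (c + 1 - 1)) = m := by rw [hm, hM, mul_comm]
  have hm0 : 0 < m := by
    have := Nat.one_lt_pow hpos.ne' (show 1 < c + 1 by omega)
    omega
  refine ⟨hsN, by simp [hdm], M, ?_, ?_⟩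
  · rcases Nat.eq_zero_or_pos M with h | h
    · simp [h] at hMm
      omega
    · exact h
  · rw [hsN, hMm, hdm, List.reverse_replicate, ← hdm, Nat.ofDigits_digits, hN, sq]
end

section
/- Let b ≥ 3 satisfy b ≡ 3 (mod 4) and let k ≥ 2. Then m = b^(2^(k−1)) − 1 is a b-Niven number; equivalently, s_b(m) = 2^(k−1)·(b − 1) divides b^(2^(k−1)) − 1. -/
theorem Nat.sum_digits_pow_sub_one {b : ℕ} (hb : 1 < b) (n : ℕ) :
    (Nat.digits b (b ^ n - 1)).sum = n * (b - 1) := by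
  induction n with
  | zero => simp
  | succ n ih =>
    have hsplit : b ^ (n + 1) - 1 = (b - 1) + b * (b ^ n - 1) := by
      rw [Nat.mul_sub, mul_one, ← pow_succ', Nat.succ_eq_add_one]
      have hle : b ≤ b ^ (n + 1) := Nat.le_self_pow n.succ_ne_zero b
      omega
    rw [hsplit, Nat.digits_add b hb (b - 1) (b ^ n - 1) (by omega) (Or.inl (by omega)),
      List.sum_cons, ih]
    ring

theorem Odd.two_pow_mul_sub_one_dvd_pow_two_pow_sub_one {b : ℕ} (hb : Odd b) (n : ℕ) :
    2 ^ n * (b - 1) ∣ b ^ (2 ^ n) - 1 := by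
  induction n with
  | zero => simp
  | succ n ih =>
    have hfactor : b ^ (2 ^ (n + 1)) - 1 = (b ^ (2 ^ n) + 1) * (b ^ (2 ^ n) - 1) := by
      rw [pow_succ 2 n, pow_mul, ← Nat.sq_sub_sq, one_pow]
    rw [hfactor, pow_succ', mul_assoc]
    exact mul_dvd_mul (hb.pow.add_odd odd_one).two_dvd ih

/-- Let `b ≥ 3` with `b ≡ 3 (mod 4)` and `k ≥ 2`. Then `m = b ^ (2 ^ (k-1)) - 1`
is a `b`-Niven number; equivalently, `s_b(m) = 2 ^ (k - 1) * (b - 1)` and it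
divides `b ^ (2 ^ (k - 1)) - 1`. -/
theorem stmt_12 (b k m : ℕ) (hb : 3 ≤ b) (hbm : b % 4 = 3) (hk : 2 ≤ k)
    (hm : m = b ^ (2 ^ (k - 1)) - 1) :
    (Nat.digits b m).sum = 2 ^ (k - 1) * (b - 1) ∧
    2 ^ (k - 1) * (b - 1) ∣ b ^ (2 ^ (k - 1)) - 1 := by
  subst hm
  exact ⟨Nat.sum_digits_pow_sub_one (by omega) _,
    Odd.two_pow_mul_sub_one_dvd_pow_two_pow_sub_one (Nat.odd_iff.mpr (by omega)) _⟩
end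

section
/- If b ≥ 3 is odd, then there exist infinitely many multiplicative multipliers in base b; i.e., the set of positive integers M such that M is a multiplicative multiplier of some positive integer N is infinite. -/
theorem ofDigits_map_range (b n : ℕ) (f : ℕ → ℕ) :
    Nat.ofDigits b ((List.range n).map f) = ∑ i ∈ Finset.range n, f i * b ^ i := by
  induction n with
  | zero => simp
  | succ n ih =>
    rw [List.range_succ, List.map_append, Nat.ofDigits_append, ih, Finset.sum_range_succ]
    simp [mul_comm]

theorem sum_range_indicator (S : Finset ℕ) (L : ℕ) (hmax : ∀ n ∈ S, n ≤ L) (g : ℕ → ℕ) :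
    ∑ i ∈ Finset.range (L + 1), (if i ∈ S then 1 else 0) * g i = ∑ i ∈ S, g i := by
  simp only [ite_mul, one_mul, zero_mul]
  rw [← Finset.sum_filter]
  refine Finset.sum_congr ?_ fun _ _ => rfl
  ext i
  simp only [Finset.mem_filter, Finset.mem_range]
  exact ⟨fun h => h.2, fun h => ⟨Nat.lt_succ_of_le (hmax i h), h⟩⟩

theorem digits_sum_pow {b : ℕ} (hb : 1 < b) (S : Finset ℕ) (L : ℕ) (hL : L ∈ S)
    (hmax : ∀ n ∈ S, n ≤ L) :
    Nat.digits b (∑ n ∈ S, b ^ n) =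
      (List.range (L + 1)).map fun n => if n ∈ S then 1 else 0 := by
  rw [← sum_range_indicator S L hmax, ← ofDigits_map_range]
  apply Nat.digits_ofDigits b hb
  · intro d hd
    simp only [List.mem_map] at hd
    obtain ⟨n, -, rfl⟩ := hd
    split_ifs <;> omega
  · intro h
    simp [List.range_succ, hL]

theorem sum_digits_sum_pow {b : ℕ} (hb : 1 < b) (S : Finset ℕ) (hS : S.Nonempty) :
    (Nat.digits b (∑ n ∈ S, b ^ n)).sum = S.card := by
  rw [digits_sum_pow hb S (S.max' hS) (S.max'_mem hS) (fun n hn => S.le_max' n hn)]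
  have h := sum_range_indicator S (S.max' hS) (fun n hn => S.le_max' n hn) (fun _ => 1)
  have h2 := ofDigits_map_range 1 (S.max' hS + 1) (fun n => if n ∈ S then 1 else 0)
  simp only [Nat.ofDigits_one, one_pow] at h2
  rw [h2, h]
  simp

theorem ofDigits_reverse_digits_sum_pow {b : ℕ} (hb : 1 < b) (S : Finset ℕ) (L : ℕ)
    (hL : L ∈ S) (hmax : ∀ n ∈ S, n ≤ L) :
    Nat.ofDigits b (Nat.digits b (∑ n ∈ S, b ^ n)).reverse = ∑ n ∈ S, b ^ (L - n) := by
  have hrev : ((List.range (L + 1)).map fun n => if n ∈ S then 1 else 0).reverse =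
      (List.range (L + 1)).map fun n => if L - n ∈ S then 1 else 0 := by
    apply List.ext_getElem <;> simp
  rw [digits_sum_pow hb S L hL hmax, hrev, ofDigits_map_range,
    ← sum_range_indicator S L hmax, ← Finset.sum_range_reflect]
  refine Finset.sum_congr rfl fun i hi => ?_
  have hi : i < L + 1 := Finset.mem_range.1 hi
  have h1 : L + 1 - 1 - i = L - i := by omega
  have h2 : L - (L - i) = i := by omega
  rw [h1, h2]

/-- Residues modulo `6` whose powers of `b` cancel modulo `b ^ 2 - b + 1`. -/
def residue (i : ℕ) : ℕ := if i < 3 then 2 * i else if i % 2 = 0 then 3 else 0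

/-- A rapidly growing sequence of exponents with prescribed residues modulo `6`. -/
def exponent (i : ℕ) : ℕ := 6 * 4 ^ i + residue i

theorem residue_le (i : ℕ) : residue i ≤ 4 := by
  unfold residue; split_ifs <;> omega

theorem two_mul_exponent_lt {i j : ℕ} (h : j < i) : 2 * exponent j + 1 < exponent i := by
  have h1 : 4 ^ (j + 1) ≤ 4 ^ i := Nat.pow_le_pow_right (by norm_num) h
  have h2 : 0 < 4 ^ j := by positivity
  have h3 := residue_le j
  unfold exponent
  rw [pow_succ] at h1
  omega

theorem exponent_strictMono : StrictMono exponent := fun j i h => by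
  have := two_mul_exponent_lt h
  omega

theorem exponent_add_eq {i j k l : ℕ} (hij : i ≠ j) (hkl : k ≠ l)
    (h : exponent i + exponent l = exponent k + exponent j) : i = k ∧ j = l := by
  have key : ∀ {x y : ℕ}, y < x → 2 * exponent y + 1 < exponent x := two_mul_exponent_lt
  rcases lt_trichotomy i k with hik | hik | hik
  · have := key hik
    rcases lt_or_ge l k with hlk | hlk
    · have := key hlk; omega
    · have := key (lt_of_le_of_ne hlk hkl)
      rcases lt_trichotomy l j with h1 | h1 | h1
      · have := key h1; omega
      · subst h1; omega
      · have := key h1; omega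
  · subst hik
    exact ⟨rfl, exponent_strictMono.injective (by omega)⟩
  · have := key hik
    rcases lt_or_ge j i with hji | hji
    · have := key hji; omega
    · have := key (lt_of_le_of_ne hji hij)
      rcases lt_trichotomy l j with h1 | h1 | h1
      · have := key h1; omega
      · subst h1; omega
      · have := key h1; omega

theorem pow_exponent_modEq (b : ℤ) (i : ℕ) :
    b ^ exponent i ≡ b ^ residue i [ZMOD b ^ 2 - b + 1] := by
  have h : b ^ 6 ≡ 1 [ZMOD b ^ 2 - b + 1] := by
    apply Int.ModEq.symm
    rw [Int.modEq_iff_dvd]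
    exact ⟨(b + 1) * (b ^ 3 - 1), by ring⟩
  have := ((h.pow (4 ^ i)).mul_right (b ^ residue i))
  rwa [one_pow, one_mul, ← pow_mul, ← pow_add] at this

theorem dvd_sum_pow_exponent (b : ℤ) (m : ℕ) :
    b ^ 2 - b + 1 ∣ ∑ i ∈ Finset.range (2 * m + 3), b ^ exponent i := by
  suffices h : b ^ 2 - b + 1 ∣ ∑ i ∈ Finset.range (2 * m + 3), b ^ residue i by
    exact (Int.ModEq.dvd_iff (Int.ModEq.sum fun i _ => pow_exponent_modEq b i)).2 h
  induction m with
  | zero =>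
    simp only [mul_zero, zero_add, Finset.sum_range_succ, Finset.sum_range_zero, residue]
    exact ⟨b ^ 2 + b + 1, by norm_num; ring⟩
  | succ m ih =>
    rw [show 2 * (m + 1) + 3 = 2 * m + 3 + 1 + 1 by ring, Finset.sum_range_succ,
      Finset.sum_range_succ, add_assoc]
    refine dvd_add ih ?_
    have h1 : residue (2 * m + 3) = 0 := by unfold residue; split_ifs <;> omega
    have h2 : residue (2 * m + 3 + 1) = 3 := by unfold residue; split_ifs <;> omega
    rw [h1, h2]
    exact ⟨b + 1, by ring⟩

theorem sum_mul_sum_reflect_eq (b n : ℕ) (e : ℕ → ℕ) (L : ℕ) (he : ∀ i < n, e i ≤ L) :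
    (∑ i ∈ Finset.range n, b ^ e i) * ∑ j ∈ Finset.range n, b ^ (L - e j) =
      n * b ^ L + ∑ p ∈ (Finset.range n).offDiag, b ^ (L + e p.1 - e p.2) := by
  rw [Finset.sum_mul_sum, ← Finset.sum_product', ← Finset.diag_union_offDiag,
    Finset.sum_union (Finset.disjoint_diag_offDiag _)]
  congr 1
  · rw [Finset.sum_diag, Finset.sum_congr rfl (g := fun _ => b ^ L)]
    · simp
    · intro i hi
      have := he i (Finset.mem_range.1 hi)
      simp only
      rw [← pow_add, show e i + (L - e i) = L by omega]
  · refine Finset.sum_congr rfl fun p hp => ?_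
    have := he p.2 (Finset.mem_range.1 (Finset.mem_offDiag.1 hp).2.1)
    rw [← pow_add, show e p.1 + (L - e p.2) = L + e p.1 - e p.2 by omega]

theorem exists_dvd_sum_digits_mul_reverse {b : ℕ} (hb : 3 ≤ b) (hbo : Odd b) :
    ∃ A : ℕ, 0 < A ∧
      (Nat.digits b (A * Nat.ofDigits b (Nat.digits b A).reverse)).sum ∣ A ∧
      0 < A * Nat.ofDigits b (Nat.digits b A).reverse := by
  obtain ⟨m, hm⟩ : ∃ m, b = 2 * m + 3 := by
    obtain ⟨k, hk⟩ := hbo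
    exact ⟨k - 1, by omega⟩
  have hb1 : 1 < b := by omega
  set L := exponent (b - 1) with hLdef
  have hle : ∀ i < b, exponent i ≤ L := fun i hi =>
    exponent_strictMono.monotone (by omega)
  set S := (Finset.range b).image exponent with hS
  have hLS : L ∈ S := Finset.mem_image.2 ⟨b - 1, Finset.mem_range.2 (by omega), rfl⟩
  have hmax : ∀ n ∈ S, n ≤ L := by
    intro n hn
    obtain ⟨i, hi, rfl⟩ := Finset.mem_image.1 hn
    exact hle i (Finset.mem_range.1 hi)
  have hsum : ∀ g : ℕ → ℕ, ∑ n ∈ S, g n = ∑ i ∈ Finset.range b, g (exponent i) := fun g =>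
    Finset.sum_image fun _ _ _ _ h => exponent_strictMono.injective h
  set T := insert (L + 1)
    ((Finset.range b).offDiag.image fun p => L + exponent p.1 - exponent p.2) with hT
  have hinj : Set.InjOn (fun p : ℕ × ℕ => L + exponent p.1 - exponent p.2)
      ((Finset.range b).offDiag : Set (ℕ × ℕ)) := by
    rintro ⟨i, j⟩ hp ⟨k, l⟩ hq h
    simp only [Finset.coe_offDiag, Set.mem_offDiag, Finset.coe_range, Set.mem_Iio] at hp hq h
    have h1 := hle j hp.2.1
    have h2 := hle l hq.2.1
    obtain ⟨rfl, rfl⟩ := exponent_add_eq hp.2.2 hq.2.2 (by omega)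
    rfl
  have hnot : L + 1 ∉
      (Finset.range b).offDiag.image fun p => L + exponent p.1 - exponent p.2 := by
    intro h
    obtain ⟨⟨i, j⟩, hp, h⟩ := Finset.mem_image.1 h
    simp only [Finset.mem_offDiag, Finset.mem_range] at hp h
    have h1 := hle j hp.2.1
    rcases lt_or_gt_of_ne hp.2.2 with hij | hij
    · have := two_mul_exponent_lt hij; omega
    · have := two_mul_exponent_lt hij; omega
  have hN : (∑ n ∈ S, b ^ n) * Nat.ofDigits b (Nat.digits b (∑ n ∈ S, b ^ n)).reverse =
      ∑ n ∈ T, b ^ n := by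
    rw [ofDigits_reverse_digits_sum_pow hb1 S L hLS hmax, hsum, hsum,
      sum_mul_sum_reflect_eq b b exponent L hle, hT, Finset.sum_insert hnot,
      Finset.sum_image hinj, pow_succ']
  have hcard : T.card = b * b - b + 1 := by
    rw [hT, Finset.card_insert_of_notMem hnot, Finset.card_image_of_injOn hinj,
      Finset.offDiag_card, Finset.card_range]
  have hpos : ∀ U : Finset ℕ, U.Nonempty → 0 < ∑ n ∈ U, b ^ n := fun U hU =>
    Finset.sum_pos (fun _ _ => by positivity) hU
  have hTne : T.Nonempty := ⟨L + 1, Finset.mem_insert_self _ _⟩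
  refine ⟨∑ n ∈ S, b ^ n, hpos S ⟨L, hLS⟩, ?_, hN ▸ hpos T hTne⟩
  rw [hN, sum_digits_sum_pow hb1 T hTne, hcard, hsum]
  have h := dvd_sum_pow_exponent b m
  rw [← hm] at h
  zify [Nat.le_mul_self b]
  rwa [← sq]

theorem ofDigits_reverse_digits_base_pow_mul {b : ℕ} (hb : 1 < b) (t : ℕ) {A : ℕ} (hA : 0 < A) :
    Nat.ofDigits b (Nat.digits b (b ^ t * A)).reverse =
      Nat.ofDigits b (Nat.digits b A).reverse := by
  rw [Nat.digits_base_pow_mul hb hA, List.reverse_append, List.reverse_replicate,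
    Nat.ofDigits_append_replicate_zero]

/-- If `b ≥ 3` is odd, there exist infinitely many multiplicative multipliers
in base `b`: the set of positive integers `M` such that `M` is a multiplicative
multiplier of some positive integer `N` is infinite. -/
theorem stmt_13 (b : ℕ) (hb : 3 ≤ b) (hbo : Odd b) :
    {M : ℕ | 0 < M ∧ ∃ N : ℕ, 0 < N ∧
      N = M * (Nat.digits b N).sum *
        Nat.ofDigits b (Nat.digits b (M * (Nat.digits b N).sum)).reverse}.Infinite := by
  have hb1 : 1 < b := by omega
  obtain ⟨A, hA, ⟨M, hM⟩, hN⟩ := exists_dvd_sum_digits_mul_reverse hb hbo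
  set N := A * Nat.ofDigits b (Nat.digits b A).reverse with hNdef
  have hMpos : 0 < M := Nat.pos_of_ne_zero fun h => by simp [h] at hM; omega
  refine Set.infinite_of_injective_forall_mem (f := fun t => b ^ t * M) ?_ fun t => ?_
  · intro s t h
    exact Nat.pow_right_injective hb1 (Nat.eq_of_mul_eq_mul_right hMpos h)
  · refine ⟨by positivity, b ^ t * N, by positivity, ?_⟩
    have hs : (Nat.digits b (b ^ t * N)).sum = (Nat.digits b N).sum := by
      rw [Nat.digits_base_pow_mul hb1 hN]
      simp
    have hMs : b ^ t * M * (Nat.digits b N).sum = b ^ t * A := by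
      rw [mul_assoc, mul_comm M, ← hM]
    rw [hs, hMs, ofDigits_reverse_digits_base_pow_mul hb1 t hA, mul_assoc]
end

section
/- Let b ≥ 2 be a base and let N be a positive integer with k base-b digits that is a b-ARH number with additive multiplier M, i.e., N = M·s_b(N) + (M·s_b(N))^R. Then k ≤ M + 2 if b ≥ 4, and k ≤ M + 3 if b = 2 or b = 3. -/
theorem sum_digits_le_length_mul {b : ℕ} (hb : 2 ≤ b) (N : ℕ) :
    (Nat.digits b N).sum ≤ (Nat.digits b N).length * (b - 1) := by
  have h := List.sum_le_card_nsmul (Nat.digits b N) (b - 1) fun d hd => by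
    have := Nat.digits_lt_base (by omega : 1 < b) hd
    omega
  simpa using h

theorem length_digits_add_reverse_le {b : ℕ} (hb : 2 ≤ b) (P : ℕ) :
    (Nat.digits b (P + Nat.ofDigits b (Nat.digits b P).reverse)).length ≤
      (Nat.digits b P).length + 1 := by
  have hP : P < b ^ (Nat.digits b P).length := Nat.lt_base_pow_length_digits (by omega)
  have hR : Nat.ofDigits b (Nat.digits b P).reverse < b ^ (Nat.digits b P).length := by
    have h := Nat.ofDigits_lt_base_pow_length (b := b) (l := (Nat.digits b P).reverse) (by omega)
      fun d hd => Nat.digits_lt_base (by omega) (List.mem_reverse.mp hd)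
    simpa using h
  rw [Nat.digits_length_le_iff (by omega), pow_succ]
  nlinarith

theorem pow_length_digits_le_of_eq_add_reverse {b N M : ℕ} (hb : 2 ≤ b) (hNpos : 0 < N)
    (hARH : N = M * (Nat.digits b N).sum +
      Nat.ofDigits b (Nat.digits b (M * (Nat.digits b N).sum)).reverse) :
    b ^ (Nat.digits b N).length ≤ b ^ 2 * (M * ((Nat.digits b N).length * (b - 1))) := by
  have hP : M * (Nat.digits b N).sum ≠ 0 := by
    intro h
    rw [h] at hARH
    simp at hARH
    omega
  have hlen := length_digits_add_reverse_le hb (M * (Nat.digits b N).sum)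
  rw [← hARH] at hlen
  have hpow := Nat.base_pow_length_digits_le b _ (by omega) hP
  calc b ^ (Nat.digits b N).length
      ≤ b ^ ((Nat.digits b (M * (Nat.digits b N).sum)).length + 1) :=
        Nat.pow_le_pow_right (by omega) hlen
    _ = b * b ^ (Nat.digits b (M * (Nat.digits b N).sum)).length := pow_succ' _ _
    _ ≤ b * (b * (M * (Nat.digits b N).sum)) := Nat.mul_le_mul_left _ hpow
    _ = b ^ 2 * (M * (Nat.digits b N).sum) := by ring
    _ ≤ _ := by gcongr; exact sum_digits_le_length_mul hb N

theorem mul_add_three_le_four_pow (j : ℕ) : (j + 1) * (j + 4) ≤ 4 ^ (j + 1) := by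
  induction j with
  | zero => norm_num
  | succ j ih => rw [pow_succ]; nlinarith

theorem mul_add_four_add_three_le_two_pow (j : ℕ) : (j + 1) * (j + 5) + 3 ≤ 2 ^ (j + 3) := by
  induction j with
  | zero => norm_num
  | succ j ih => rw [pow_succ]; nlinarith

theorem two_mul_mul_add_four_lt_three_pow (j : ℕ) : (j + 1) * (j + 5) * 2 < 3 ^ (j + 3) := by
  induction j with
  | zero => norm_num
  | succ j ih => rw [pow_succ]; nlinarith

/-- Let `b ≥ 2` and let `N` be a positive integer with `k` base-`b` digits that
is a `b`-ARH number with additive multiplier `M`. Then `k ≤ M + 2` if `b ≥ 4`,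
and `k ≤ M + 3` if `b = 2` or `b = 3`. -/
theorem stmt_16 (b N M k : ℕ) (hb : 2 ≤ b) (hNpos : 0 < N)
    (hk : k = (Nat.digits b N).length) (hM : 0 < M)
    (hARH : N = M * (Nat.digits b N).sum +
      Nat.ofDigits b (Nat.digits b (M * (Nat.digits b N).sum)).reverse) :
    (4 ≤ b → k ≤ M + 2) ∧ (b = 2 ∨ b = 3 → k ≤ M + 3) := by
  have key := pow_length_digits_le_of_eq_add_reverse hb hNpos hARH
  rw [← hk] at key
  clear hARH hk
  constructor
  · intro hb4
    by_contra! hlt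
    obtain ⟨j, rfl⟩ : ∃ j, k = j + 4 := ⟨k - 4, by omega⟩
    rw [show j + 4 = 2 + (j + 2) by ring, pow_add] at key
    have hle : b ^ (j + 2) ≤ M * ((2 + (j + 2)) * (b - 1)) :=
      Nat.le_of_mul_le_mul_left key (by positivity)
    have hlow : (j + 1) * (j + 4) ≤ b ^ (j + 1) :=
      (mul_add_three_le_four_pow j).trans (Nat.pow_le_pow_left hb4 _)
    have hup : b ^ (j + 2) ≤ b ^ (j + 1) * (b - 1) :=
      calc b ^ (j + 2) ≤ M * ((2 + (j + 2)) * (b - 1)) := hle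
        _ ≤ (j + 1) * ((2 + (j + 2)) * (b - 1)) := Nat.mul_le_mul_right _ (by omega)
        _ = (j + 1) * (j + 4) * (b - 1) := by ring
        _ ≤ _ := Nat.mul_le_mul_right _ hlow
    rw [pow_succ b (j + 1)] at hup
    have := Nat.le_of_mul_le_mul_left hup (by positivity)
    omega
  · intro hb23
    by_contra! hlt
    obtain ⟨j, rfl⟩ : ∃ j, k = j + 5 := ⟨k - 5, by omega⟩
    rw [show j + 5 = 2 + (j + 3) by ring, pow_add] at key
    have hle : b ^ (j + 3) ≤ (j + 1) * (j + 5) * (b - 1) :=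
      calc b ^ (j + 3) ≤ M * ((2 + (j + 3)) * (b - 1)) :=
            Nat.le_of_mul_le_mul_left key (by positivity)
        _ ≤ (j + 1) * ((2 + (j + 3)) * (b - 1)) := Nat.mul_le_mul_right _ (by omega)
        _ = _ := by ring
    rcases hb23 with rfl | rfl
    · have := mul_add_four_add_three_le_two_pow j
      omega
    · have := two_mul_mul_add_four_lt_three_pow j
      omega
end

section
/- Let b ≥ 2 be a base and let N be a positive integer with k base-b digits that is a b-MRH number with multiplicative multiplier M, i.e., N = M·s_b(N)·(M·s_b(N))^R. Then k ≤ M + 4 if b ≥ 6, k ≤ M + 5 if b = 5, and k ≤ M + 7 if 2 ≤ b ≤ 4. -/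
theorem Nat.sum_digits_le_pred_mul_length {b : ℕ} (hb : 2 ≤ b) (n : ℕ) :
    (Nat.digits b n).sum ≤ (b - 1) * (Nat.digits b n).length := by
  have h := List.sum_le_card_nsmul (Nat.digits b n) (b - 1)
    fun x hx => Nat.le_sub_one_of_lt (Nat.digits_lt_base hb hx)
  rwa [smul_eq_mul, mul_comm] at h

theorem Nat.ofDigits_reverse_digits_lt {b a : ℕ} (hb : 2 ≤ b) (ha : a ≠ 0) :
    Nat.ofDigits b (Nat.digits b a).reverse < b * a := by
  calc Nat.ofDigits b (Nat.digits b a).reverse < b ^ (Nat.digits b a).reverse.length :=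
        Nat.ofDigits_lt_base_pow_length hb fun x hx =>
          Nat.digits_lt_base hb (List.mem_reverse.mp hx)
    _ = b ^ (Nat.digits b a).length := by rw [List.length_reverse]
    _ ≤ b * a := Nat.base_pow_length_digits_le b a hb ha

/-- If `N` has multiplicative multiplier `M`, then `b ^ k`, where `k` is the number of digits
of `N`, is bounded by a quadratic expression in `k` and `M`. -/
theorem pow_length_digits_lt_of_mul_reverse {b N M : ℕ} (hb : 2 ≤ b) (hN : 0 < N)
    (h : N = M * (Nat.digits b N).sum *
      Nat.ofDigits b (Nat.digits b (M * (Nat.digits b N).sum)).reverse) :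
    b ^ (Nat.digits b N).length <
      b ^ 2 * ((b - 1) * (Nat.digits b N).length * M) ^ 2 := by
  have hS := Nat.sum_digits_le_pred_mul_length hb N
  set A := M * (Nat.digits b N).sum with hA
  have hA0 : A ≠ 0 := by
    intro h0
    rw [h0, zero_mul] at h
    omega
  have hAle : A ≤ (b - 1) * (Nat.digits b N).length * M := by
    rw [hA, mul_comm]
    exact Nat.mul_le_mul_right M hS
  calc b ^ (Nat.digits b N).length ≤ b * N := Nat.base_pow_length_digits_le b N hb hN.ne'
    _ = b * (A * Nat.ofDigits b (Nat.digits b A).reverse) := by rw [← h]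
    _ < b * (A * (b * A)) := by
        have := Nat.ofDigits_reverse_digits_lt hb hA0
        have : 0 < A := Nat.pos_of_ne_zero hA0
        gcongr
    _ = b ^ 2 * A ^ 2 := by ring
    _ ≤ _ := by gcongr

theorem sq_le_six_pow (m : ℕ) : ((m + 6) * (m + 1)) ^ 2 ≤ 36 * 6 ^ m := by
  induction m with
  | zero => norm_num
  | succ m ih =>
    rw [pow_succ 6]
    nlinarith [Nat.zero_le (m ^ 2), Nat.zero_le (m ^ 3), Nat.zero_le (m ^ 4)]

theorem sq_le_five_pow (m : ℕ) : (4 * (m + 7) * (m + 1)) ^ 2 ≤ 5 ^ (m + 5) := by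
  rcases m with _ | m
  · norm_num
  induction m with
  | zero => norm_num
  | succ m ih =>
    rw [show m + 1 + 1 + 5 = m + 1 + 5 + 1 by ring, pow_succ 5]
    nlinarith [Nat.zero_le (m ^ 2), Nat.zero_le (m ^ 3), Nat.zero_le (m ^ 4)]

theorem sq_le_three_pow (m : ℕ) : (2 * (m + 9) * (m + 1)) ^ 2 ≤ 3 ^ (m + 7) := by
  rcases m with _ | m
  · norm_num
  induction m with
  | zero => norm_num
  | succ m ih =>
    rw [show m + 1 + 1 + 7 = m + 1 + 7 + 1 by ring, pow_succ 3]
    nlinarith [Nat.zero_le (m ^ 2), Nat.zero_le (m ^ 3), Nat.zero_le (m ^ 4)]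

theorem sq_le_four_pow (m : ℕ) : (3 * (m + 9) * (m + 1)) ^ 2 ≤ 4 ^ (m + 7) := by
  rcases m with _ | m
  · norm_num
  induction m with
  | zero => norm_num
  | succ m ih =>
    rw [show m + 1 + 1 + 7 = m + 1 + 7 + 1 by ring, pow_succ 4]
    nlinarith [Nat.zero_le (m ^ 2), Nat.zero_le (m ^ 3), Nat.zero_le (m ^ 4)]

theorem sq_le_two_pow {m : ℕ} (hm : 7 ≤ m) : ((m + 9) * (m + 1)) ^ 2 ≤ 2 ^ (m + 7) := by
  obtain ⟨m, rfl⟩ := Nat.exists_eq_add_of_le' hm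
  clear hm
  induction m with
  | zero => norm_num
  | succ m ih =>
    rw [show m + 1 + 7 + 7 = m + 7 + 7 + 1 by ring, pow_succ 2]
    nlinarith [Nat.zero_le (m ^ 2), Nat.zero_le (m ^ 3), Nat.zero_le (m ^ 4)]

theorem binary_length_le_of_small : ∀ M < 8, ∀ S < 16,
    (Nat.digits 2 (M * S * Nat.ofDigits 2 (Nat.digits 2 (M * S)).reverse)).sum = S →
    (Nat.digits 2 (M * S * Nat.ofDigits 2 (Nat.digits 2 (M * S)).reverse)).length ≤ M + 7 := by
  decide +kernel

/-- Let `b ≥ 2` and let `N` be a positive integer with `k` base-`b` digits that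
is a `b`-MRH number with multiplicative multiplier `M`. Then `k ≤ M + 4` if
`b ≥ 6`, `k ≤ M + 5` if `b = 5`, and `k ≤ M + 7` if `2 ≤ b ≤ 4`. -/
theorem stmt_18 (b N M k : ℕ) (hb : 2 ≤ b) (hNpos : 0 < N)
    (hk : k = (Nat.digits b N).length) (hM : 0 < M)
    (hMRH : N = M * (Nat.digits b N).sum *
      Nat.ofDigits b (Nat.digits b (M * (Nat.digits b N).sum)).reverse) :
    (6 ≤ b → k ≤ M + 4) ∧ (b = 5 → k ≤ M + 5) ∧ (b ≤ 4 → k ≤ M + 7) := by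
  have key := pow_length_digits_lt_of_mul_reverse hb hNpos hMRH
  rw [← hk] at key
  have reduce {j m : ℕ} (hkj : k = m + j + 2) (hMm : M ≤ m + 1) :
      b ^ (m + j) < ((b - 1) * (m + j + 2) * (m + 1)) ^ 2 := by
    rw [hkj, pow_add, mul_comm] at key
    exact (Nat.lt_of_mul_lt_mul_left key).trans_le (by gcongr)
  refine ⟨fun h6 => ?_, fun h5 => ?_, fun h4 => ?_⟩
  · by_contra! hlt
    obtain ⟨m, rfl⟩ : ∃ m, k = m + 4 + 2 := ⟨k - 6, by omega⟩
    refine (reduce rfl (by omega)).not_ge ?_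
    have hsq : 6 * (b - 1) ≤ b ^ 2 := by
      obtain ⟨c, rfl⟩ := Nat.exists_eq_add_of_le' h6
      rw [show c + 6 - 1 = c + 5 by omega]
      nlinarith
    calc ((b - 1) * (m + 4 + 2) * (m + 1)) ^ 2
        = (b - 1) ^ 2 * ((m + 6) * (m + 1)) ^ 2 := by ring
      _ ≤ (b - 1) ^ 2 * (36 * 6 ^ m) := by gcongr; exact sq_le_six_pow m
      _ = 6 ^ m * (6 * (b - 1)) ^ 2 := by ring
      _ ≤ b ^ m * (b ^ 2) ^ 2 := by gcongr
      _ = b ^ (m + 4) := by ring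
  · subst h5
    by_contra! hlt
    obtain ⟨m, rfl⟩ : ∃ m, k = m + 5 + 2 := ⟨k - 7, by omega⟩
    exact (reduce rfl (by omega)).not_ge (sq_le_five_pow m)
  · by_contra! hlt
    obtain ⟨m, hm⟩ : ∃ m, k = m + 7 + 2 := ⟨k - 9, by omega⟩
    have hred := reduce hm (by omega)
    interval_cases b
    · have hm7 : m < 7 := by
        by_contra! hm7
        exact hred.not_ge (by simpa using sq_le_two_pow hm7)
      have hS := Nat.sum_digits_le_pred_mul_length hb N
      have hsmall := binary_length_le_of_small M (by omega) (Nat.digits 2 N).sum (by omega)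
      rw [← hMRH] at hsmall
      have := hsmall rfl
      omega
    · exact hred.not_ge (sq_le_three_pow m)
    · exact hred.not_ge (sq_le_four_pow m)
end
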